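/- arXiv:1612.09306 — 6 statements merged into one kernel-verified Lean document; each statement's English description precedes it below -/
import Mathlib

section
/- Gadget completeness for the 3XOR-to-2-out-of-4-SAT reduction: for all x₁, x₂, x₃, z ∈ {−1,1} with x₁·x₂·x₃·z = 1, there exist y₁, y₂, y₃ ∈ {−1,1} such that x₁ + y₂ + y₃ + z = 0, x₂ + y₁ + y₃ + z = 0, and x₃ + y₁ + y₂ + z = 0. -/
/-- gadget completeness for the 3XOR-to-2-out-of-4-SAT reduction. -/
theorem gadget_completeness (x₁ x₂ x₃ z : ℝ)
    (hx₁ : x₁ = 1 ∨ x₁ = -1) (hx₂ : x₂ = 1 ∨ x₂ = -1)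
    (hx₃ : x₃ = 1 ∨ x₃ = -1) (hz : z = 1 ∨ z = -1)
    (hxor : x₁ * x₂ * x₃ * z = 1) :
    ∃ y₁ y₂ y₃ : ℝ, (y₁ = 1 ∨ y₁ = -1) ∧ (y₂ = 1 ∨ y₂ = -1) ∧ (y₃ = 1 ∨ y₃ = -1) ∧
      x₁ + y₂ + y₃ + z = 0 ∧ x₂ + y₁ + y₃ + z = 0 ∧ x₃ + y₁ + y₂ + z = 0 := by
  refine ⟨(x₁ - x₂ - x₃ - z) / 2, (x₂ - x₁ - x₃ - z) / 2, (x₃ - x₁ - x₂ - z) / 2,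
    ?_, ?_, ?_, by ring, by ring, by ring⟩ <;>
  rcases hx₁ with rfl | rfl <;> rcases hx₂ with rfl | rfl <;>
  rcases hx₃ with rfl | rfl <;> rcases hz with rfl | rfl <;>
  norm_num at hxor <;> norm_num
end

section
/- Gadget soundness for the 3XOR-to-2-out-of-4-SAT reduction: for all x₁, x₂, x₃, y₁, y₂, y₃, z ∈ {−1,1}, if x₁ + y₂ + y₃ + z = 0, x₂ + y₁ + y₃ + z = 0, and x₃ + y₁ + y₂ + z = 0, then x₁·x₂·x₃·z = 1. Consequently, if x₁·x₂·x₃·z = −1, then at most two of the three 2-out-of-4 constraints can hold simultaneously. -/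
/-- Four signs with zero sum have product one. -/
theorem mul_eq_one_of_signs_of_sum_eq_zero {a b c d : ℝ}
    (ha : a = 1 ∨ a = -1) (hb : b = 1 ∨ b = -1) (hc : c = 1 ∨ c = -1) (hd : d = 1 ∨ d = -1)
    (h : a + b + c + d = 0) : a * b * c * d = 1 := by
  rcases ha with rfl | rfl <;> rcases hb with rfl | rfl <;> rcases hc with rfl | rfl <;>
    rcases hd with rfl | rfl <;> linarith

/-- gadget soundness for the 3XOR-to-2-out-of-4-SAT reduction. -/
theorem gadget_soundness (x₁ x₂ x₃ y₁ y₂ y₃ z : ℝ)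
    (hx₁ : x₁ = 1 ∨ x₁ = -1) (hx₂ : x₂ = 1 ∨ x₂ = -1) (hx₃ : x₃ = 1 ∨ x₃ = -1)
    (hy₁ : y₁ = 1 ∨ y₁ = -1) (hy₂ : y₂ = 1 ∨ y₂ = -1) (hy₃ : y₃ = 1 ∨ y₃ = -1)
    (hz : z = 1 ∨ z = -1)
    (h1 : x₁ + y₂ + y₃ + z = 0) (h2 : x₂ + y₁ + y₃ + z = 0)
    (h3 : x₃ + y₁ + y₂ + z = 0) :
    x₁ * x₂ * x₃ * z = 1 := by
  have p₁ := mul_eq_one_of_signs_of_sum_eq_zero hx₁ hy₂ hy₃ hz h1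
  have p₂ := mul_eq_one_of_signs_of_sum_eq_zero hx₂ hy₁ hy₃ hz h2
  have p₃ := mul_eq_one_of_signs_of_sum_eq_zero hx₃ hy₁ hy₂ hz h3
  have h : x₁ * x₂ * x₃ * z * (y₁ ^ 2 * y₂ ^ 2 * y₃ ^ 2 * z ^ 2) = 1 := by
    calc _ = (x₁ * y₂ * y₃ * z) * (x₂ * y₁ * y₃ * z) * (x₃ * y₁ * y₂ * z) := by ring
      _ = 1 := by rw [p₁, p₂, p₃]; norm_num
  simpa only [sq_eq_one_iff.mpr hy₁, sq_eq_one_iff.mpr hy₂, sq_eq_one_iff.mpr hy₃,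
    sq_eq_one_iff.mpr hz, mul_one] using h
end

section
/- Integrality gap for 2-out-of-4-SAT-EQ: there exist constants δ ∈ (0,1), c > 0 and n₀ such that for every n ≥ n₀ there exists a 2-out-of-4-SAT-EQ instance Φ_n over N = O(n) variables with the following properties. Let Obj_n(x) denote the fraction of clauses of Φ_n satisfied by x, written as a polynomial of degree 4: a 2-out-of-4 clause with signed-variable sum s contributes the predicate (s² − 4)(s² − 16)/64 and an EQ clause on literals ℓ_a, ℓ_b contributes (1 + ℓ_a·ℓ_b)/2. Then: (i) Obj_n(x) ≤ 1 − δ for every x ∈ {−1,1}^N; (ii) there exists a degree-⌈c·n⌉ pseudo-expectation E over ℝ[x₁,…,x_N] satisfying the Boolean constraints with E[Obj_n] = 1; and moreover (iii) for every 2-out-of-4 clause of Φ_n with literals ℓ₁, ℓ₂, ℓ₃, ℓ₄ and every polynomial p of total degree at most c·n − 1, E[(ℓ₁ + ℓ₂ + ℓ₃ + ℓ₄)·p] = 0. -/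
open MvPolynomial
open scoped Classical

/-- A Boolean (±1) assignment. -/
def IsPM {ι : Type*} (x : ι → ℝ) : Prop := ∀ i, x i = 1 ∨ x i = -1

/-- A clause of a 2-out-of-4-SAT-EQ instance: either a 2-out-of-4 clause on four
literals, or an equality clause on two literals.  A literal is a variable index
together with a sign (`true` codes `+1`, `false` codes `-1`). -/
inductive TFClause (N : ℕ)
  | four (l₁ l₂ l₃ l₄ : Fin N × Bool)
  | eq (l₁ l₂ : Fin N × Bool)

/-- The polynomial corresponding to a literal: the signed variable. -/
noncomputable def litPoly {N : ℕ} (l : Fin N × Bool) : MvPolynomial (Fin N) ℝ :=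
  C (if l.2 then 1 else -1) * X l.1

/-- The 0/1-valued predicate polynomial of a clause: a 2-out-of-4 clause with
signed-variable sum `s` contributes `(s² − 4)(s² − 16)/64`, and an EQ clause on
literals `ℓ_a, ℓ_b` contributes `(1 + ℓ_a·ℓ_b)/2`. -/
noncomputable def clausePoly {N : ℕ} : TFClause N → MvPolynomial (Fin N) ℝ
  | .four l₁ l₂ l₃ l₄ =>
      C (1 / 64) *
        (((litPoly l₁ + litPoly l₂ + litPoly l₃ + litPoly l₄) ^ 2 - 4) *
          ((litPoly l₁ + litPoly l₂ + litPoly l₃ + litPoly l₄) ^ 2 - 16))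
  | .eq l₁ l₂ => C (1 / 2) * (1 + litPoly l₁ * litPoly l₂)

/-- The objective polynomial: the fraction of clauses of `Φ` satisfied. -/
noncomputable def objPoly {N : ℕ} (Φ : List (TFClause N)) : MvPolynomial (Fin N) ℝ :=
  C (1 / (Φ.length : ℝ)) * (Φ.map clausePoly).sum

open Finset

/-- A symmetric kernel with values in `{-1, 0, 1}` that is multiplicative along its nonzero entries
is positive semidefinite. -/
theorem sum_mul_kernel_nonneg {ι : Type*} [Fintype ι] (K : ι → ι → ℝ)
    (hsymm : ∀ v w, K v w = K w v) (hdiag : ∀ v, K v v = 1)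
    (hmul : ∀ v w z, K v w ≠ 0 → K v z = K v w * K w z) (f : ι → ℝ) :
    0 ≤ ∑ v, ∑ w, f v * f w * K v w := by
  have hsq : ∀ v w, K v w ≠ 0 → K v w ^ 2 = 1 := by
    intro v w h
    have := hmul v w v h
    rw [hdiag, hsymm w v] at this
    rw [this]; ring
  set c : ι → ℝ := fun v => ∑ z, K v z ^ 2 with hc
  have hcpos : ∀ v, 0 < c v := by
    intro v
    refine Finset.sum_pos' (fun z _ => sq_nonneg _) ⟨v, mem_univ _, ?_⟩
    simp [hdiag]
  have hceq : ∀ v w, K v w ≠ 0 → c v = c w := by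
    intro v w h
    refine Finset.sum_congr rfl fun z _ => ?_
    rw [hmul v w z h, mul_pow, hsq v w h, one_mul]
  have hconv : ∀ v w, ∑ z, K v z * K w z = c v * K v w := by
    intro v w
    by_cases h : K v w = 0
    · rw [h, mul_zero]
      refine Finset.sum_eq_zero fun z _ => ?_
      by_cases hz : K v z = 0
      · rw [hz, zero_mul]
      · have := hmul v z w hz
        rw [hsymm w z, ← this, h]
    · rw [hceq v w h, hc, Finset.sum_mul]
      refine Finset.sum_congr rfl fun z _ => ?_
      rw [hmul v w z h]; ring
  have key : ∑ v, ∑ w, f v * f w * K v w = ∑ z, (∑ v, f v / √(c v) * K v z) ^ 2 := by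
    simp_rw [sq, Finset.sum_mul_sum]
    rw [Finset.sum_comm (γ := ι) (s := univ) (t := univ) (f := fun z v => ∑ w, _)]
    refine Finset.sum_congr rfl fun v _ => ?_
    rw [Finset.sum_comm]
    refine Finset.sum_congr rfl fun w _ => ?_
    have h1 : ∑ z, f v / √(c v) * K v z * (f w / √(c w) * K w z)
        = f v / √(c v) * (f w / √(c w)) * (c v * K v w) := by
      rw [← hconv, Finset.mul_sum]
      exact Finset.sum_congr rfl fun z _ => by ring
    rw [h1]
    by_cases h : K v w = 0
    · simp [h]
    · rw [← hceq v w h]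
      have h2 : √(c v) ≠ 0 := (Real.sqrt_pos.2 (hcpos v)).ne'
      have h3 : √(c v) * √(c v) = c v := Real.mul_self_sqrt (hcpos v).le
      field_simp
      rw [sq, h3]
  rw [key]
  exact Finset.sum_nonneg fun z _ => sq_nonneg _

/-- The sign character of `ZMod 2`. -/
noncomputable def zsign (a : ZMod 2) : ℝ := if a = 0 then 1 else -1

theorem zsign_add (a b : ZMod 2) : zsign (a + b) = zsign a * zsign b := by
  have h : ∀ a b : ZMod 2, a = 0 ∧ b = 0 ∧ a + b = 0 ∨ a = 0 ∧ b ≠ 0 ∧ a + b ≠ 0 ∨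
    a ≠ 0 ∧ b = 0 ∧ a + b ≠ 0 ∨ a ≠ 0 ∧ b ≠ 0 ∧ a + b = 0 := by decide
  rcases h a b with ⟨h1, h2, h3⟩ | ⟨h1, h2, h3⟩ | ⟨h1, h2, h3⟩ | ⟨h1, h2, h3⟩ <;>
    simp [zsign, h1, h2, h3]

theorem zsign_zero : zsign 0 = 1 := by simp [zsign]

theorem zsign_mul_self (a : ZMod 2) : zsign a * zsign a = 1 := by
  unfold zsign; split_ifs <;> norm_num

section Refutation

variable {ι μ : Type*} [Fintype ι] [Fintype μ]

theorem hammingNorm_add_le (v w : ι → ZMod 2) :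
    hammingNorm (v + w) ≤ hammingNorm v + hammingNorm w := by
  have h := hammingDist_triangle v 0 (-w)
  have hneg : -w = w := by ext i; exact ZModModule.neg_eq_self (w i)
  rwa [hammingDist_zero_right, hammingDist_zero_left, hneg, hammingDist_eq_hammingNorm,
    ZModModule.neg_eq_self] at h

/-- `IsSumExpanding A R` says that a sum of at most `R` rows of `A`
has at least as many nonzero entries as it has summands. -/
def IsSumExpanding (A : Matrix μ ι (ZMod 2)) (R : ℕ) : Prop :=
  ∀ t : μ → ZMod 2, hammingNorm t ≤ R → hammingNorm t ≤ hammingNorm (Matrix.vecMul t A)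

/-- The value assigned to the character `v` by the low-weight consequences of the linear system
`A x = b`: the implied sign if `v` is a sum of at most `W` rows, and zero otherwise. -/
noncomputable def derivedSign (A : Matrix μ ι (ZMod 2)) (b : μ → ZMod 2) (W : ℕ)
    (v : ι → ZMod 2) : ℝ :=
  if h : ∃ t : μ → ZMod 2, hammingNorm t ≤ W ∧ Matrix.vecMul t A = v then
    zsign (h.choose ⬝ᵥ b) else 0

variable {A : Matrix μ ι (ZMod 2)} {b : μ → ZMod 2} {W : ℕ}

theorem IsSumExpanding.vecMul_injOn (hA : IsSumExpanding A (2 * W)) {s t : μ → ZMod 2}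
    (hs : hammingNorm s ≤ W) (ht : hammingNorm t ≤ W)
    (h : Matrix.vecMul s A = Matrix.vecMul t A) : s = t := by
  have h1 := hA (s + t) ((hammingNorm_add_le s t).trans (by omega))
  rw [Matrix.add_vecMul, h, ZModModule.add_self, hammingNorm_zero, Nat.le_zero,
    hammingNorm_eq_zero] at h1
  rwa [← ZModModule.sub_eq_add, sub_eq_zero] at h1

theorem IsSumExpanding.derivedSign_vecMul (hA : IsSumExpanding A (2 * W)) {t : μ → ZMod 2}
    (ht : hammingNorm t ≤ W) : derivedSign A b W (Matrix.vecMul t A) = zsign (t ⬝ᵥ b) := by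
  have h : ∃ s : μ → ZMod 2, hammingNorm s ≤ W ∧ Matrix.vecMul s A = Matrix.vecMul t A :=
    ⟨t, ht, rfl⟩
  rw [derivedSign, dif_pos h, hA.vecMul_injOn h.choose_spec.1 ht h.choose_spec.2]

theorem exists_of_derivedSign_ne_zero {v : ι → ZMod 2} (h : derivedSign A b W v ≠ 0) :
    ∃ t : μ → ZMod 2, hammingNorm t ≤ W ∧ Matrix.vecMul t A = v := by
  by_contra h'
  exact h (dif_neg h')

theorem IsSumExpanding.derivedSign_zero (hA : IsSumExpanding A (2 * W)) :
    derivedSign A b W 0 = 1 := by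
  have := hA.derivedSign_vecMul (b := b) (t := 0) (by simp)
  rwa [Matrix.zero_vecMul, zero_dotProduct, zsign_zero] at this

theorem IsSumExpanding.derivedSign_add (hA : IsSumExpanding A (2 * W)) {D : ℕ} (hD : 2 * D ≤ W)
    {v w z : ι → ZMod 2} (hv : hammingNorm v ≤ D) (hw : hammingNorm w ≤ D)
    (hz : hammingNorm z ≤ D) (h : derivedSign A b W (v + w) ≠ 0) :
    derivedSign A b W (v + z) = derivedSign A b W (v + w) * derivedSign A b W (w + z) := by
  obtain ⟨s, hs, hsv⟩ := exists_of_derivedSign_ne_zero h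
  have hvz : hammingNorm (v + z) ≤ W := (hammingNorm_add_le v z).trans (by omega)
  by_cases hwz : ∃ t : μ → ZMod 2, hammingNorm t ≤ W ∧ Matrix.vecMul t A = w + z
  · obtain ⟨t, ht, htv⟩ := hwz
    have hst : Matrix.vecMul (s + t) A = v + z := by
      rw [Matrix.add_vecMul, hsv, htv, add_assoc, ← add_assoc w w z, ZModModule.add_self, zero_add]
    have hle : hammingNorm (s + t) ≤ W := by
      have := hA (s + t) ((hammingNorm_add_le s t).trans (by omega))
      rw [hst] at this
      exact this.trans hvz
    rw [← hst, hA.derivedSign_vecMul hle, ← hsv, hA.derivedSign_vecMul hs, ← htv,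
      hA.derivedSign_vecMul ht, add_dotProduct, zsign_add]
  · rw [derivedSign, derivedSign, derivedSign, dif_neg hwz, mul_zero, dif_neg]
    rintro ⟨t, ht, htv⟩
    have hst : Matrix.vecMul (s + t) A = w + z := by
      rw [Matrix.add_vecMul, hsv, htv, add_add_add_comm, ZModModule.add_self, zero_add]
    have hle := hA (s + t) ((hammingNorm_add_le s t).trans (by omega))
    rw [hst] at hle
    exact hwz ⟨s + t, hle.trans ((hammingNorm_add_le w z).trans (by omega)), hst⟩

/-- The linear functional on the group algebra of `ι → ZMod 2` with values `derivedSign A b W`. -/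
noncomputable def derivedFunctional (A : Matrix μ ι (ZMod 2)) (b : μ → ZMod 2) (W : ℕ) :
    AddMonoidAlgebra ℝ (ι → ZMod 2) →ₗ[ℝ] ℝ :=
  Finsupp.linearCombination ℝ (derivedSign A b W) ∘ₗ
    (AddMonoidAlgebra.coeffLinearEquiv ℝ).toLinearMap

theorem derivedFunctional_single (v : ι → ZMod 2) (r : ℝ) :
    derivedFunctional A b W (AddMonoidAlgebra.single v r) = r * derivedSign A b W v := by
  simp [derivedFunctional, Finsupp.linearCombination_single]

/-- The elements of the group algebra of `ι → ZMod 2` of Fourier degree at most `D`. -/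
noncomputable def fourierDegreeLE (ι : Type*) [Fintype ι] (D : ℕ) :
    Submodule ℝ (AddMonoidAlgebra ℝ (ι → ZMod 2)) :=
  Submodule.span ℝ (Set.range fun v : {v : ι → ZMod 2 // hammingNorm v ≤ D} =>
    AddMonoidAlgebra.single v.1 (1 : ℝ))

theorem IsSumExpanding.derivedFunctional_sq_nonneg (hA : IsSumExpanding A (2 * W)) {D : ℕ}
    (hD : 2 * D ≤ W) {f : AddMonoidAlgebra ℝ (ι → ZMod 2)} (hf : f ∈ fourierDegreeLE ι D) :
    0 ≤ derivedFunctional A b W (f ^ 2) := by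
  obtain ⟨c, hc⟩ := (Submodule.mem_span_range_iff_exists_fun ℝ).1 hf
  rw [← hc, sq, Finset.sum_mul_sum, map_sum]
  simp_rw [map_sum, smul_mul_smul_comm, AddMonoidAlgebra.single_mul_single, map_smul,
    derivedFunctional_single, smul_eq_mul, one_mul]
  have hK := sum_mul_kernel_nonneg
    (fun v w : {v : ι → ZMod 2 // hammingNorm v ≤ D} => derivedSign A b W (v.1 + w.1))
    (fun v w => by rw [add_comm])
    (fun v => by rw [ZModModule.add_self, hA.derivedSign_zero])
    (fun v w z h => hA.derivedSign_add hD v.2 w.2 z.2 h) c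
  exact hK

theorem single_mem_fourierDegreeLE {D : ℕ} {v : ι → ZMod 2} (hv : hammingNorm v ≤ D) (r : ℝ) :
    AddMonoidAlgebra.single v r ∈ fourierDegreeLE ι D := by
  have := (fourierDegreeLE ι D).smul_mem r (Submodule.subset_span ⟨⟨v, hv⟩, rfl⟩)
  simpa using this

theorem fourierDegreeLE_mono {D D' : ℕ} (h : D ≤ D') :
    fourierDegreeLE ι D ≤ fourierDegreeLE ι D' := by
  refine Submodule.span_mono ?_
  rintro _ ⟨v, rfl⟩
  exact ⟨⟨v.1, v.2.trans h⟩, rfl⟩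

theorem mul_mem_fourierDegreeLE {D D' : ℕ} {f g : AddMonoidAlgebra ℝ (ι → ZMod 2)}
    (hf : f ∈ fourierDegreeLE ι D) (hg : g ∈ fourierDegreeLE ι D') :
    f * g ∈ fourierDegreeLE ι (D + D') := by
  have h := Submodule.mul_mem_mul hf hg
  rw [fourierDegreeLE, fourierDegreeLE, Submodule.span_mul_span] at h
  refine Submodule.span_mono ?_ h
  rintro _ ⟨_, ⟨v, rfl⟩, _, ⟨w, rfl⟩, rfl⟩
  refine ⟨⟨v.1 + w.1, (hammingNorm_add_le _ _).trans (add_le_add v.2 w.2)⟩, ?_⟩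
  simp [AddMonoidAlgebra.single_mul_single]

theorem pow_mem_fourierDegreeLE {D : ℕ} {f : AddMonoidAlgebra ℝ (ι → ZMod 2)}
    (hf : f ∈ fourierDegreeLE ι D) (k : ℕ) : f ^ k ∈ fourierDegreeLE ι (D * k) := by
  induction k with
  | zero => simpa [AddMonoidAlgebra.one_def] using
      single_mem_fourierDegreeLE (ι := ι) (D := 0) (v := 0) (by simp) 1
  | succ k ih => rw [pow_succ, Nat.mul_succ]; exact mul_mem_fourierDegreeLE ih hf

theorem prod_mem_fourierDegreeLE {σ : Type*} (s : Finset σ) (D : σ → ℕ)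
    (f : σ → AddMonoidAlgebra ℝ (ι → ZMod 2)) (hf : ∀ i ∈ s, f i ∈ fourierDegreeLE ι (D i)) :
    ∏ i ∈ s, f i ∈ fourierDegreeLE ι (∑ i ∈ s, D i) := by
  induction s using Finset.induction_on with
  | empty => simpa [AddMonoidAlgebra.one_def] using
      single_mem_fourierDegreeLE (ι := ι) (D := 0) (v := 0) (by simp) 1
  | insert i s hi ih =>
    rw [prod_insert hi, sum_insert hi]
    exact mul_mem_fourierDegreeLE (hf i (mem_insert_self i s))
      (ih fun j hj => hf j (mem_insert_of_mem hj))

theorem aeval_mem_fourierDegreeLE {σ : Type*} {D : ℕ} {F : σ → AddMonoidAlgebra ℝ (ι → ZMod 2)}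
    (hF : ∀ i, F i ∈ fourierDegreeLE ι D) {d : ℕ} {p : MvPolynomial σ ℝ} (hp : p.totalDegree ≤ d) :
    aeval F p ∈ fourierDegreeLE ι (D * d) := by
  rw [aeval_def, eval₂_eq]
  refine Submodule.sum_mem _ fun m hm => ?_
  rw [← Algebra.smul_def]
  refine Submodule.smul_mem _ _ (fourierDegreeLE_mono ?_
    (prod_mem_fourierDegreeLE m.support (fun i => D * m i) _
      fun i _ => pow_mem_fourierDegreeLE (hF i) (m i)))
  rw [← Finset.mul_sum]
  exact Nat.mul_le_mul_left D ((le_totalDegree hm).trans hp)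

end Refutation

section Instance

variable {n m N : ℕ}

/-- The variables of the instance: the `n` original ones, and three auxiliary ones for each half
of each of the `m` parity constraints. -/
abbrev GadgetVar (n m : ℕ) : Type := Fin n ⊕ Fin m × Fin 2 × Fin 3

/-- The coefficient matrix over `ZMod 2` of the parity constraints with index triples `g j 0` and
`g j 1`. -/
def parityMatrix (g : Fin m → Fin 2 → Fin 3 → Fin n) : Matrix (Fin m) (Fin n) (ZMod 2) :=
  fun j => ∑ h, ∑ k, Pi.single (g j h k) 1

/-- Two clauses forcing `y = x₀ x₁ x₂`, where `y` is the third auxiliary variable of the half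
constraint `(j, h)`. -/
def halfGadget (e : GadgetVar n m ≃ Fin N) (g : Fin m → Fin 2 → Fin 3 → Fin n)
    (j : Fin m) (h : Fin 2) : List (TFClause N) :=
  [.four (e (.inl (g j h 0)), true) (e (.inl (g j h 1)), true)
      (e (.inr (j, h, 0)), false) (e (.inr (j, h, 1)), false),
    .four (e (.inl (g j h 2)), true) (e (.inr (j, h, 2)), false)
      (e (.inr (j, h, 0)), false) (e (.inr (j, h, 1)), true)]

/-- The five clauses encoding the parity constraint `j`. -/
def parityGadget (e : GadgetVar n m ≃ Fin N) (g : Fin m → Fin 2 → Fin 3 → Fin n)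
    (b : Fin m → ZMod 2) (j : Fin m) : List (TFClause N) :=
  halfGadget e g j 0 ++ halfGadget e g j 1 ++
    [.eq (e (.inr (j, 0, 2)), true) (e (.inr (j, 1, 2)), decide (b j = 0))]

/-- The instance encoding all the parity constraints. -/
def parityInstance (e : GadgetVar n m ≃ Fin N) (g : Fin m → Fin 2 → Fin 3 → Fin n)
    (b : Fin m → ZMod 2) : List (TFClause N) :=
  (List.finRange m).flatMap (parityGadget e g b)

theorem length_parityInstance (e : GadgetVar n m ≃ Fin N) (g : Fin m → Fin 2 → Fin 3 → Fin n)
    (b : Fin m → ZMod 2) : (parityInstance e g b).length = 5 * m := by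
  simp [parityInstance, List.length_flatMap, parityGadget, halfGadget, mul_comm]

theorem objPoly_parityInstance (e : GadgetVar n m ≃ Fin N)
    (g : Fin m → Fin 2 → Fin 3 → Fin n) (b : Fin m → ZMod 2) :
    objPoly (parityInstance e g b) =
      C (1 / (5 * m : ℝ)) * ∑ j, ((parityGadget e g b j).map clausePoly).sum := by
  rw [objPoly, length_parityInstance, parityInstance, List.map_flatMap,
    List.flatMap_def, List.sum_flatten, List.map_map, ← List.ofFn_eq_map, List.sum_ofFn]
  push_cast
  rfl

theorem four_value {a b c d : ℝ} (ha : a = 1 ∨ a = -1) (hb : b = 1 ∨ b = -1)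
    (hc : c = 1 ∨ c = -1) (hd : d = 1 ∨ d = -1) :
    1 / 64 * (((a + b + c + d) ^ 2 - 4) * ((a + b + c + d) ^ 2 - 16)) = 0 ∨
      1 / 64 * (((a + b + c + d) ^ 2 - 4) * ((a + b + c + d) ^ 2 - 16)) = 1 ∧
        a + b + c + d = 0 := by
  rcases ha with rfl | rfl <;> rcases hb with rfl | rfl <;> rcases hc with rfl | rfl <;>
    rcases hd with rfl | rfl <;> norm_num

theorem eq_value {a b : ℝ} (ha : a = 1 ∨ a = -1) (hb : b = 1 ∨ b = -1) :
    1 / 2 * (1 + a * b) = 0 ∨ 1 / 2 * (1 + a * b) = 1 ∧ a = b := by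
  rcases ha with rfl | rfl <;> rcases hb with rfl | rfl <;> norm_num

theorem eq_mul_of_adder {a b c M u y : ℝ} (ha : a = 1 ∨ a = -1) (hb : b = 1 ∨ b = -1)
    (hc : c = 1 ∨ c = -1) (hM : M = 1 ∨ M = -1) (hu : u = 1 ∨ u = -1) (hy : y = 1 ∨ y = -1)
    (h₁ : a + b + -M + -u = 0) (h₂ : c + -y + -M + u = 0) : y = a * b * c := by
  rcases ha with rfl | rfl <;> rcases hb with rfl | rfl <;> rcases hc with rfl | rfl <;>
    rcases hM with rfl | rfl <;> rcases hu with rfl | rfl <;> rcases hy with rfl | rfl <;>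
    first | (exfalso; norm_num at h₁; done) | (exfalso; norm_num at h₂; done) | norm_num

theorem eval_litPoly (x : Fin N → ℝ) (i : Fin N) (s : Bool) :
    eval x (litPoly (i, s)) = if s then x i else - x i := by
  cases s <;> simp [litPoly]

theorem eval_clausePoly_four (x : Fin N → ℝ) (l₁ l₂ l₃ l₄ : Fin N × Bool) :
    eval x (clausePoly (.four l₁ l₂ l₃ l₄)) =
      1 / 64 * (((eval x (litPoly l₁) + eval x (litPoly l₂) + eval x (litPoly l₃) +
        eval x (litPoly l₄)) ^ 2 - 4) * ((eval x (litPoly l₁) + eval x (litPoly l₂) +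
        eval x (litPoly l₃) + eval x (litPoly l₄)) ^ 2 - 16)) := by
  simp [clausePoly]

theorem eval_clausePoly_eq (x : Fin N → ℝ) (l₁ l₂ : Fin N × Bool) :
    eval x (clausePoly (.eq l₁ l₂)) =
      1 / 2 * (1 + eval x (litPoly l₁) * eval x (litPoly l₂)) := by
  simp [clausePoly]

theorem IsPM.eval_litPoly {x : Fin N → ℝ} (hx : IsPM x) (l : Fin N × Bool) :
    eval x (litPoly l) = 1 ∨ eval x (litPoly l) = -1 := by
  obtain ⟨i, s⟩ := l
  rw [_root_.eval_litPoly]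
  rcases hx i with h | h <;> cases s <;> simp [h]

theorem IsPM.eval_halfGadget {x : Fin N → ℝ} (hx : IsPM x) (e : GadgetVar n m ≃ Fin N)
    (g : Fin m → Fin 2 → Fin 3 → Fin n) (j : Fin m) (h : Fin 2) :
    eval x ((halfGadget e g j h).map clausePoly).sum ≤ 1 ∨
      eval x ((halfGadget e g j h).map clausePoly).sum = 2 ∧
        x (e (.inr (j, h, 2))) = ∏ k, x (e (.inl (g j h k))) := by
  simp only [halfGadget, List.map_cons, List.map_nil, List.sum_cons, List.sum_nil, map_add,
    add_zero, eval_clausePoly_four]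
  rcases four_value (hx.eval_litPoly (e (.inl (g j h 0)), true))
    (hx.eval_litPoly (e (.inl (g j h 1)), true)) (hx.eval_litPoly (e (.inr (j, h, 0)), false))
    (hx.eval_litPoly (e (.inr (j, h, 1)), false)) with h₁ | ⟨h₁, h₁'⟩ <;>
  rcases four_value (hx.eval_litPoly (e (.inl (g j h 2)), true))
    (hx.eval_litPoly (e (.inr (j, h, 2)), false)) (hx.eval_litPoly (e (.inr (j, h, 0)), false))
    (hx.eval_litPoly (e (.inr (j, h, 1)), true)) with h₂ | ⟨h₂, h₂'⟩ <;> rw [h₁, h₂]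
  · left; norm_num
  · left; norm_num
  · left; norm_num
  · right
    refine ⟨by norm_num, ?_⟩
    simp only [_root_.eval_litPoly, if_true, Bool.false_eq_true, if_false] at h₁' h₂'
    rw [Fin.prod_univ_three]
    exact eq_mul_of_adder (hx _) (hx _) (hx _) (hx _) (hx _) (hx _) h₁' h₂'

theorem zsign_sum {σ : Type*} (s : Finset σ) (f : σ → ZMod 2) :
    zsign (∑ i ∈ s, f i) = ∏ i ∈ s, zsign (f i) := by
  induction s using Finset.induction_on with
  | empty => simp [zsign_zero]
  | insert i s hi ih => rw [sum_insert hi, prod_insert hi, zsign_add, ih]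

theorem zsign_injective : Function.Injective zsign := by
  intro a b h
  have hab := zsign_add a b
  rw [h, zsign_mul_self] at hab
  unfold zsign at hab
  split_ifs at hab with h0
  · rwa [← ZModModule.sub_eq_add, sub_eq_zero] at h0
  · norm_num at hab

theorem parityMatrix_mulVec (g : Fin m → Fin 2 → Fin 3 → Fin n) (X : Fin n → ZMod 2)
    (j : Fin m) : (parityMatrix g).mulVec X j = ∑ h, ∑ k, X (g j h k) := by
  simp only [Matrix.mulVec, parityMatrix, sum_dotProduct, single_dotProduct, one_mul]

theorem IsPM.eval_parityGadget {x : Fin N → ℝ} (hx : IsPM x) (e : GadgetVar n m ≃ Fin N)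
    (g : Fin m → Fin 2 → Fin 3 → Fin n) (b : Fin m → ZMod 2) {X : Fin n → ZMod 2}
    (hX : ∀ i, x (e (.inl i)) = zsign (X i)) (j : Fin m) :
    eval x ((parityGadget e g b j).map clausePoly).sum ≤
      5 - if (parityMatrix g).mulVec X j ≠ b j then 1 else 0 := by
  simp only [parityGadget, List.map_append, List.sum_append, map_add, List.map_cons, List.map_nil,
    List.sum_cons, List.sum_nil, add_zero, eval_clausePoly_eq]
  have hite : (if (parityMatrix g).mulVec X j ≠ b j then 1 else 0 : ℝ) ≤ 1 := by
    split_ifs <;> norm_num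
  rcases eq_value (hx.eval_litPoly (e (.inr (j, 0, 2)), true))
    (hx.eval_litPoly (e (.inr (j, 1, 2)), decide (b j = 0))) with h₂ | ⟨h₂, h₂'⟩ <;>
  rcases hx.eval_halfGadget e g j 0 with h₀ | ⟨h₀, h₀'⟩ <;>
  rcases hx.eval_halfGadget e g j 1 with h₁ | ⟨h₁, h₁'⟩ <;> rw [h₂] <;> try linarith
  rw [if_neg, h₀, h₁]
  · norm_num
  · rw [not_not, parityMatrix_mulVec, Fin.sum_univ_two]
    apply zsign_injective
    rw [zsign_add, zsign_sum, zsign_sum]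
    simp_rw [← hX]
    rw [← h₀', ← h₁']
    simp only [_root_.eval_litPoly, if_true] at h₂'
    rw [h₂']
    rcases hx (e (.inr (j, 1, 2))) with h | h <;> by_cases hb : b j = 0 <;> simp [h, hb, zsign]

theorem IsPM.eval_objPoly_parityInstance {x : Fin N → ℝ} (hx : IsPM x)
    (e : GadgetVar n m ≃ Fin N) (g : Fin m → Fin 2 → Fin 3 → Fin n) (b : Fin m → ZMod 2)
    {w : ℕ} (hb : ∀ X, w ≤ hammingDist ((parityMatrix g).mulVec X) b) (hm : 0 < m) :
    eval x (objPoly (parityInstance e g b)) ≤ 1 - w / (5 * m) := by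
  set X : Fin n → ZMod 2 := fun i => if x (e (.inl i)) = 1 then 0 else 1
  have hX : ∀ i, x (e (.inl i)) = zsign (X i) := by
    intro i
    simp only [X]
    rcases hx (e (.inl i)) with h | h
    · simp [h, zsign]
    · rw [if_neg (by rw [h]; norm_num), h]; simp [zsign]
  have hsum : ∑ j, eval x ((parityGadget e g b j).map clausePoly).sum ≤ 5 * m - w := by
    refine (Finset.sum_le_sum fun j _ => hx.eval_parityGadget e g b hX j).trans ?_
    rw [Finset.sum_sub_distrib, Finset.sum_boole]
    have h1 : (w : ℝ) ≤ (#{j | (parityMatrix g).mulVec X j ≠ b j} : ℕ) := by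
      have := hb X
      rw [hammingDist] at this
      convert (Nat.cast_le (α := ℝ)).2 this
    simp only [Finset.sum_const, Finset.card_univ, Fintype.card_fin, nsmul_eq_mul]
    linarith
  have hm' : (0 : ℝ) < m := by exact_mod_cast hm
  rw [objPoly_parityInstance, map_mul, eval_C, map_sum]
  calc _ ≤ 1 / (5 * (m : ℝ)) * (5 * m - w) := by gcongr
    _ = _ := by field_simp

/-- The majority of three signs, as a multilinear polynomial, where `c = 1 / 2`. -/
def majority {R : Type*} [CommRing R] (c x y z : R) : R := c * (x + y + z - x * y * z)

theorem majority_sq {R : Type*} [CommRing R] {c x y z : R} (hc : 2 * c = 1) (hx : x ^ 2 = 1)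
    (hy : y ^ 2 = 1) (hz : z ^ 2 = 1) : majority c x y z ^ 2 = 1 := by
  have h : (x + y + z - x * y * z) ^ 2 = 4 := by
    linear_combination (1 + y ^ 2 * z ^ 2 - 2 * y * z) * hx + (1 + z ^ 2 - 2 * x * z) * hy +
      (2 - 2 * x * y) * hz
  rw [majority, mul_pow, h]
  linear_combination (2 * c + 1) * hc

variable (n) in
/-- The character of a single variable, in the group algebra. -/
noncomputable def charX (i : Fin n) : AddMonoidAlgebra ℝ (Fin n → ZMod 2) :=
  AddMonoidAlgebra.single (Pi.single i 1) 1

theorem charX_sq (i : Fin n) : charX n i ^ 2 = 1 := by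
  rw [charX, sq, AddMonoidAlgebra.single_mul_single, ZModModule.add_self, mul_one,
    AddMonoidAlgebra.one_def]

/-- The values of the variables of the instance in the group algebra of the original variables. -/
noncomputable def gadgetValue (g : Fin m → Fin 2 → Fin 3 → Fin n) :
    GadgetVar n m → AddMonoidAlgebra ℝ (Fin n → ZMod 2)
  | .inl i => charX n i
  | .inr (j, h, k) =>
      ![majority (algebraMap ℝ _ (1 / 2)) (charX n (g j h 0)) (charX n (g j h 1))
          (charX n (g j h 2)),
        majority (algebraMap ℝ _ (1 / 2)) (charX n (g j h 0)) (charX n (g j h 1))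
          (- charX n (g j h 2)),
        charX n (g j h 0) * charX n (g j h 1) * charX n (g j h 2)] k

theorem two_mul_algebraMap_half {R : Type*} [CommRing R] [Algebra ℝ R] :
    2 * algebraMap ℝ R (1 / 2) = 1 := by
  rw [← map_ofNat (algebraMap ℝ R) 2, ← map_mul]
  norm_num

theorem gadgetValue_sq (g : Fin m → Fin 2 → Fin 3 → Fin n) (v : GadgetVar n m) :
    gadgetValue g v ^ 2 = 1 := by
  rcases v with i | ⟨j, h, k⟩
  · exact charX_sq i
  · fin_cases k
    · exact majority_sq two_mul_algebraMap_half (charX_sq _) (charX_sq _) (charX_sq _)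
    · exact majority_sq two_mul_algebraMap_half (charX_sq _) (charX_sq _)
        (by rw [neg_sq, charX_sq])
    · change (charX n (g j h 0) * charX n (g j h 1) * charX n (g j h 2)) ^ 2 = 1
      rw [mul_pow, mul_pow, charX_sq, charX_sq, charX_sq, one_mul, one_mul]

theorem charX_mem_fourierDegreeLE (i : Fin n) : charX n i ∈ fourierDegreeLE (Fin n) 1 := by
  refine single_mem_fourierDegreeLE ?_ 1
  rw [hammingNorm]
  refine (Finset.card_le_card (t := {i}) fun k hk => ?_).trans (card_singleton i).le
  by_contra hne
  rw [mem_singleton] at hne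
  simp [hne] at hk

theorem majority_mem_fourierDegreeLE {x y z : AddMonoidAlgebra ℝ (Fin n → ZMod 2)}
    (hx : x ∈ fourierDegreeLE (Fin n) 1) (hy : y ∈ fourierDegreeLE (Fin n) 1)
    (hz : z ∈ fourierDegreeLE (Fin n) 1) (r : ℝ) :
    majority (algebraMap ℝ _ r) x y z ∈ fourierDegreeLE (Fin n) 3 := by
  have hmono := fourierDegreeLE_mono (ι := Fin n) (show 1 ≤ 3 by norm_num)
  have hmul := mul_mem_fourierDegreeLE (mul_mem_fourierDegreeLE hx hy) hz
  rw [majority, ← Algebra.smul_def]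
  exact Submodule.smul_mem _ _ (Submodule.sub_mem _
    (Submodule.add_mem _ (Submodule.add_mem _ (hmono hx) (hmono hy)) (hmono hz)) hmul)

theorem gadgetValue_mem_fourierDegreeLE (g : Fin m → Fin 2 → Fin 3 → Fin n)
    (v : GadgetVar n m) : gadgetValue g v ∈ fourierDegreeLE (Fin n) 3 := by
  rcases v with i | ⟨j, h, k⟩
  · exact fourierDegreeLE_mono (by norm_num) (charX_mem_fourierDegreeLE i)
  · fin_cases k
    · exact majority_mem_fourierDegreeLE (charX_mem_fourierDegreeLE _)
        (charX_mem_fourierDegreeLE _) (charX_mem_fourierDegreeLE _) _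
    · exact majority_mem_fourierDegreeLE (charX_mem_fourierDegreeLE _)
        (charX_mem_fourierDegreeLE _) (Submodule.neg_mem _ (charX_mem_fourierDegreeLE _)) _
    · have hmul := mul_mem_fourierDegreeLE (mul_mem_fourierDegreeLE
        (charX_mem_fourierDegreeLE (g j h 0)) (charX_mem_fourierDegreeLE (g j h 1)))
        (charX_mem_fourierDegreeLE (g j h 2))
      exact hmul

/-- The substitution of the auxiliary variables by functions of the original ones. -/
noncomputable def gadgetEval (e : GadgetVar n m ≃ Fin N) (g : Fin m → Fin 2 → Fin 3 → Fin n) :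
    MvPolynomial (Fin N) ℝ →ₐ[ℝ] AddMonoidAlgebra ℝ (Fin n → ZMod 2) :=
  aeval fun i => gadgetValue g (e.symm i)

variable {e : GadgetVar n m ≃ Fin N} {g : Fin m → Fin 2 → Fin 3 → Fin n} {b : Fin m → ZMod 2}

theorem gadgetEval_litPoly (v : GadgetVar n m) (s : Bool) :
    gadgetEval e g (litPoly (e v, s)) = if s then gadgetValue g v else - gadgetValue g v := by
  cases s <;> simp [litPoly, gadgetEval]

theorem gadgetEval_four_halfGadget {l₁ l₂ l₃ l₄ : Fin N × Bool} {j : Fin m} {h : Fin 2}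
    (hl : TFClause.four l₁ l₂ l₃ l₄ ∈ halfGadget e g j h) :
    gadgetEval e g (litPoly l₁ + litPoly l₂ + litPoly l₃ + litPoly l₄) = 0 := by
  have hh := two_mul_algebraMap_half (R := AddMonoidAlgebra ℝ (Fin n → ZMod 2))
  simp only [halfGadget, List.mem_cons, TFClause.four.injEq, List.not_mem_nil, or_false] at hl
  rcases hl with ⟨rfl, rfl, rfl, rfl⟩ | ⟨rfl, rfl, rfl, rfl⟩
  · simp only [map_add, gadgetEval_litPoly, gadgetValue, majority, if_true, Bool.false_eq_true,
      if_false, Matrix.cons_val]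
    linear_combination (- charX n (g j h 0) - charX n (g j h 1)) * hh
  · simp only [map_add, gadgetEval_litPoly, gadgetValue, majority, if_true, Bool.false_eq_true,
      if_false, Matrix.cons_val]
    linear_combination
      (charX n (g j h 0) * charX n (g j h 1) * charX n (g j h 2) - charX n (g j h 2)) * hh

theorem gadgetEval_four {l₁ l₂ l₃ l₄ : Fin N × Bool}
    (hl : TFClause.four l₁ l₂ l₃ l₄ ∈ parityInstance e g b) :
    gadgetEval e g (litPoly l₁ + litPoly l₂ + litPoly l₃ + litPoly l₄) = 0 := by
  simp only [parityInstance, List.mem_flatMap, parityGadget, List.mem_append,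
    List.mem_singleton, reduceCtorEq, or_false] at hl
  obtain ⟨j, -, hl | hl⟩ := hl <;> exact gadgetEval_four_halfGadget hl

theorem gadgetEval_clausePoly_four {l₁ l₂ l₃ l₄ : Fin N × Bool} {j : Fin m} {h : Fin 2}
    (hl : TFClause.four l₁ l₂ l₃ l₄ ∈ halfGadget e g j h) :
    gadgetEval e g (clausePoly (.four l₁ l₂ l₃ l₄)) = 1 := by
  have h0 := gadgetEval_four_halfGadget hl
  rw [clausePoly, map_mul, map_mul, map_sub, map_sub, map_pow, h0, algHom_C]
  simp only [map_ofNat]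
  rw [zero_pow two_ne_zero, zero_sub, zero_sub, neg_mul_neg,
    ← map_ofNat (algebraMap ℝ (AddMonoidAlgebra ℝ (Fin n → ZMod 2))) 4,
    ← map_ofNat (algebraMap ℝ (AddMonoidAlgebra ℝ (Fin n → ZMod 2))) 16, ← map_mul, ← map_mul]
  norm_num
  exact AddMonoidAlgebra.one_def.symm

theorem gadgetEval_sum_halfGadget (j : Fin m) (h : Fin 2) :
    gadgetEval e g ((halfGadget e g j h).map clausePoly).sum = 2 := by
  have h1 : ∀ Q ∈ halfGadget e g j h, gadgetEval e g (clausePoly Q) = 1 := by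
    intro Q hQ
    have hQ' := hQ
    simp only [halfGadget, List.mem_cons, List.not_mem_nil, or_false] at hQ'
    rcases hQ' with rfl | rfl <;> exact gadgetEval_clausePoly_four hQ
  rw [map_list_sum, List.map_map, List.map_congr_left (g := fun _ => 1) (by simpa using h1)]
  simp [halfGadget]
  norm_num

theorem single_parityMatrix (j : Fin m) :
    gadgetValue g (.inr (j, 0, 2)) * gadgetValue g (.inr (j, 1, 2)) =
      AddMonoidAlgebra.single (parityMatrix g j) 1 := by
  simp only [gadgetValue, Matrix.cons_val, charX, AddMonoidAlgebra.single_mul_single, mul_one,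
    parityMatrix, Fin.sum_univ_two, Fin.sum_univ_three]

theorem derivedFunctional_parityGadget {W : ℕ} (hA : IsSumExpanding (parityMatrix g) (2 * W))
    (hW : 1 ≤ W) (j : Fin m) :
    derivedFunctional (parityMatrix g) b W
      (gadgetEval e g ((parityGadget e g b j).map clausePoly).sum) = 5 := by
  have hone : derivedFunctional (parityMatrix g) b W 1 = 1 := by
    rw [AddMonoidAlgebra.one_def, derivedFunctional_single, hA.derivedSign_zero, mul_one]
  have hrow : derivedSign (parityMatrix g) b W (parityMatrix g j) = zsign (b j) := by
    have := hA.derivedSign_vecMul (b := b) (t := Pi.single j 1) ?_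
    · rwa [Matrix.single_one_vecMul, single_dotProduct, one_mul] at this
    · rw [hammingNorm]
      refine (Finset.card_le_card (t := {j}) fun k hk => ?_).trans ((card_singleton j).le.trans hW)
      by_contra hne
      rw [mem_singleton] at hne
      simp [hne] at hk
  have heq : gadgetEval e g (litPoly (e (.inr (j, 0, 2)), true) *
      litPoly (e (.inr (j, 1, 2)), decide (b j = 0))) =
      zsign (b j) • AddMonoidAlgebra.single (parityMatrix g j) 1 := by
    rw [map_mul, gadgetEval_litPoly, gadgetEval_litPoly, ← single_parityMatrix]
    by_cases hb : b j = 0 <;> simp [hb, zsign]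
  rw [parityGadget, List.map_append, List.map_append, List.sum_append, List.sum_append, map_add,
    map_add (gadgetEval e g), map_add, gadgetEval_sum_halfGadget, gadgetEval_sum_halfGadget, List.map_singleton,
    List.sum_singleton, clausePoly, map_mul,
    map_add (gadgetEval e g), map_one (gadgetEval e g), heq, algHom_C, ← Algebra.smul_def,
    map_add, map_smul, map_add, map_smul, derivedFunctional_single, hrow, hone,
    show (2 : AddMonoidAlgebra ℝ (Fin n → ZMod 2)) = 1 + 1 by norm_num, map_add, hone,
    one_mul, smul_eq_mul, smul_eq_mul, zsign_mul_self]
  norm_num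

theorem derivedFunctional_objPoly {W : ℕ} (hA : IsSumExpanding (parityMatrix g) (2 * W))
    (hW : 1 ≤ W) (hm : 0 < m) :
    derivedFunctional (parityMatrix g) b W
      (gadgetEval e g (objPoly (parityInstance e g b))) = 1 := by
  have hm' : (m : ℝ) ≠ 0 := by exact_mod_cast hm.ne'
  rw [objPoly_parityInstance, map_mul, algHom_C, ← Algebra.smul_def, map_smul, map_sum, map_sum,
    Finset.sum_congr rfl fun j _ => derivedFunctional_parityGadget hA hW j]
  simp only [Finset.sum_const, Finset.card_univ, Fintype.card_fin, nsmul_eq_mul, smul_eq_mul]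
  field_simp

end Instance

section Counting

/-- The generating function of Hamming distances to a fixed binary vector, at `1 / 2`. -/
theorem sum_half_pow_hammingDist {m : ℕ} (a : Fin m → ZMod 2) :
    ∑ b, (1 / 2 : ℝ) ^ hammingDist a b = (3 / 2) ^ m := by
  have h1 : ∀ b : Fin m → ZMod 2, (1 / 2 : ℝ) ^ hammingDist a b =
      ∏ i, if a i ≠ b i then 1 / 2 else 1 := by
    intro b
    rw [Finset.prod_ite, Finset.prod_const, Finset.prod_const_one, mul_one, hammingDist]
  have h2 : ∀ c : ZMod 2, ∑ d : ZMod 2, (if c ≠ d then 1 / 2 else 1 : ℝ) = 3 / 2 := by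
    intro c
    rw [Finset.sum_ite, Finset.sum_const, Finset.sum_const]
    have hcard : ∀ c : ZMod 2, #{d : ZMod 2 | c ≠ d} = 1 ∧ #{d : ZMod 2 | ¬ c ≠ d} = 1 := by decide
    rw [(hcard c).1, (hcard c).2]
    norm_num
  have h3 := Finset.prod_univ_sum (fun _ : Fin m => (univ : Finset (ZMod 2)))
    (fun i d => (if a i ≠ d then 1 / 2 else 1 : ℝ))
  rw [Fintype.piFinset_univ] at h3
  simp_rw [h1]
  rw [← h3, Finset.prod_congr rfl fun i _ => h2 (a i), Finset.prod_const, Finset.card_univ,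
    Fintype.card_fin]

/-- A family of `2 ^ n` binary vectors of length `5 n` leaves some vector at distance at least `n`
from all of them. -/
theorem exists_forall_le_hammingDist {n : ℕ} (hn : 0 < n)
    (f : (Fin n → ZMod 2) → Fin (5 * n) → ZMod 2) : ∃ b, ∀ X, n ≤ hammingDist (f X) b := by
  by_contra! hcon
  have h1 : ∑ _b : Fin (5 * n) → ZMod 2, (1 / 2 : ℝ) ^ n ≤
      ∑ b, ∑ X, (1 / 2 : ℝ) ^ hammingDist (f X) b := by
    refine Finset.sum_le_sum fun b _ => ?_
    obtain ⟨X, hX⟩ := hcon b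
    refine le_trans ?_ (Finset.single_le_sum
      (f := fun X => (1 / 2 : ℝ) ^ hammingDist (f X) b) (fun _ _ => by positivity) (mem_univ X))
    exact pow_le_pow_of_le_one (by norm_num) (by norm_num) hX.le
  rw [Finset.sum_comm, Finset.sum_congr rfl fun X _ => sum_half_pow_hammingDist (f X)] at h1
  simp only [Finset.sum_const, Finset.card_univ, Fintype.card_fun, ZMod.card, Fintype.card_fin,
    nsmul_eq_mul, Nat.cast_pow, Nat.cast_ofNat, pow_mul] at h1
  rw [← mul_pow, ← mul_pow] at h1
  exact absurd h1 (not_le.2 (pow_lt_pow_left₀ (by norm_num) (by norm_num) hn.ne'))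

theorem choose_mul_pow_self_le (N k : ℕ) : (N.choose k : ℝ) * (k : ℝ) ^ k ≤ (3 * N) ^ k := by
  have h1 : (N.choose k : ℝ) ≤ (N : ℝ) ^ k / (k.factorial : ℝ) := Nat.choose_le_pow_div k N
  have h2 : (k : ℝ) ^ k / (k.factorial : ℝ) ≤ 3 ^ k := by
    refine (Real.pow_div_factorial_le_exp (k : ℝ) (Nat.cast_nonneg k) k).trans ?_
    rw [← mul_one (k : ℝ), Real.exp_nat_mul]
    exact pow_le_pow_left₀ (Real.exp_pos 1).le Real.exp_one_lt_three.le k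
  calc (N.choose k : ℝ) * (k : ℝ) ^ k ≤ (N : ℝ) ^ k / (k.factorial : ℝ) * (k : ℝ) ^ k := by gcongr
    _ = (N : ℝ) ^ k * ((k : ℝ) ^ k / (k.factorial : ℝ)) := by ring
    _ ≤ (N : ℝ) ^ k * 3 ^ k := by gcongr
    _ = _ := by rw [mul_pow, mul_comm]

theorem choose_mul_choose_mul_pow_le {n t : ℕ} (h : 40000 * t ≤ n) :
    ((5 * n).choose t : ℝ) * (n.choose (4 * t) : ℝ) * (4 * t : ℝ) ^ (6 * t) ≤
      (n : ℝ) ^ (6 * t) * (1 / 2) ^ t := by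
  have h1 := choose_mul_pow_self_le (5 * n) t
  have h2 := choose_mul_pow_self_le n (4 * t)
  push_cast at h1 h2
  have hn : (40000 : ℝ) * t ≤ n := by exact_mod_cast h
  calc ((5 * n).choose t : ℝ) * (n.choose (4 * t) : ℝ) * (4 * t : ℝ) ^ (6 * t)
      = (((5 * n).choose t : ℝ) * (t : ℝ) ^ t) *
        ((n.choose (4 * t) : ℝ) * (4 * t : ℝ) ^ (4 * t)) * (16 * t) ^ t := by
        rw [show 6 * t = 4 * t + 2 * t by ring, pow_add, pow_mul (4 * (t : ℝ)) 2 t,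
          show (4 * (t : ℝ)) ^ 2 = t * (16 * t) by ring, mul_pow (t : ℝ) (16 * t)]
        ring
    _ ≤ (3 * (5 * n)) ^ t * (3 * n) ^ (4 * t) * (16 * t) ^ t := by gcongr
    _ = (19440 * n ^ 5 * t) ^ t := by
        rw [pow_mul, ← mul_pow, ← mul_pow]
        ring
    _ ≤ ((n : ℝ) ^ 6 * (1 / 2)) ^ t := by
        refine pow_le_pow_left₀ (by positivity) ?_ t
        nlinarith [pow_nonneg (Nat.cast_nonneg (α := ℝ) n) 5,
          mul_le_mul_of_nonneg_left hn (pow_nonneg (Nat.cast_nonneg (α := ℝ) n) 5)]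
    _ = _ := by rw [mul_pow, ← pow_mul]

theorem sum_Icc_half_pow_lt_one (R : ℕ) : ∑ t ∈ Icc 1 R, (1 / 2 : ℝ) ^ t < 1 := by
  have h : ∑ t ∈ Icc 1 R, (1 / 2 : ℝ) ^ t = 1 - (1 / 2) ^ R := by
    induction R with
    | zero => simp
    | succ R ih => rw [Finset.sum_Icc_succ_top (by omega), ih]; ring
  rw [h]
  have : (0 : ℝ) < (1 / 2) ^ R := by positivity
  linarith

/-- There are systems of `5 n` six-element families in `Fin n` such that every small subsystem of
`t` families covers more than `4 t` points. -/
theorem exists_expanding_families {n R : ℕ} (hn : 0 < n) (hR : 40000 * R ≤ n) :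
    ∃ G : Fin (5 * n) → Fin 2 × Fin 3 → Fin n, ∀ T : Finset (Fin (5 * n)), T.Nonempty →
      #T ≤ R → 4 * #T < #(T.biUnion fun j => univ.image (G j)) := by
  by_contra! hcon
  have hcover : (univ : Finset (Fin (5 * n) → Fin 2 × Fin 3 → Fin n)) ⊆
      (Icc 1 R).biUnion fun t => (powersetCard t univ ×ˢ powersetCard (4 * t) univ).biUnion
        fun P => Fintype.piFinset fun j =>
          if j ∈ P.1 then Fintype.piFinset fun _ => P.2 else univ := by
    intro G _
    obtain ⟨T, hT, hTR, hcard⟩ := hcon G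
    obtain ⟨S, hS, -, hScard⟩ := Finset.exists_subsuperset_card_eq
      (subset_univ (T.biUnion fun j => univ.image (G j))) hcard
      (by rw [Finset.card_univ, Fintype.card_fin]; omega)
    simp only [mem_biUnion, mem_Icc, mem_product, mem_powersetCard, Fintype.mem_piFinset]
    refine ⟨#T, ⟨hT.card_pos, hTR⟩, (T, S), ⟨⟨subset_univ _, rfl⟩, subset_univ _, hScard⟩, ?_⟩
    intro j
    split_ifs with hj
    · rw [Fintype.mem_piFinset]
      exact fun a => hS (mem_biUnion.2 ⟨j, hj, mem_image_of_mem _ (mem_univ a)⟩)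
    · exact mem_univ _
  have hpiece : ∀ t ∈ Icc 1 R, ∀ P ∈ powersetCard t (univ : Finset (Fin (5 * n))) ×ˢ
      powersetCard (4 * t) (univ : Finset (Fin n)),
      #(Fintype.piFinset fun j => if j ∈ P.1 then
        Fintype.piFinset fun _ : Fin 2 × Fin 3 => P.2 else univ) =
        (4 * t) ^ (6 * t) * n ^ (6 * (5 * n - t)) := by
    intro t _ P hP
    rw [mem_product, mem_powersetCard, mem_powersetCard] at hP
    rw [Fintype.card_piFinset]
    have h1 : ∀ j, #(if j ∈ P.1 then Fintype.piFinset fun _ : Fin 2 × Fin 3 => P.2 else univ) =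
        if j ∈ P.1 then (4 * t) ^ 6 else n ^ 6 := by
      intro j
      split_ifs
      · simp [Fintype.card_piFinset, hP.2.2]
      · simp
    rw [Finset.prod_congr rfl fun j _ => h1 j, Finset.prod_ite, Finset.prod_const,
      Finset.prod_const, ← pow_mul, ← pow_mul, Finset.filter_mem_eq_inter, univ_inter, hP.1.2,
      Finset.filter_not, Finset.filter_mem_eq_inter, univ_inter, Finset.card_sdiff_of_subset
      (subset_univ _), hP.1.2, Finset.card_univ, Fintype.card_fin]
  have hle : n ^ (30 * n) ≤ ∑ t ∈ Icc 1 R, (5 * n).choose t * n.choose (4 * t) *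
      ((4 * t) ^ (6 * t) * n ^ (6 * (5 * n - t))) := by
    have h1 := (Finset.card_le_card hcover).trans Finset.card_biUnion_le
    have h2 : #(univ : Finset (Fin (5 * n) → Fin 2 × Fin 3 → Fin n)) = n ^ (30 * n) := by
      simp only [Finset.card_univ, Fintype.card_fun, Fintype.card_fin, Fintype.card_prod]
      rw [← pow_mul]
      congr 1
      ring
    rw [h2] at h1
    refine h1.trans (Finset.sum_le_sum fun t ht => Finset.card_biUnion_le.trans ?_)
    rw [Finset.sum_congr rfl (hpiece t ht), Finset.sum_const, card_product, card_powersetCard,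
      card_powersetCard, Finset.card_univ, Finset.card_univ, Fintype.card_fin, Fintype.card_fin,
      smul_eq_mul]
  have hlt : ((∑ t ∈ Icc 1 R, (5 * n).choose t * n.choose (4 * t) *
      ((4 * t) ^ (6 * t) * n ^ (6 * (5 * n - t))) : ℕ) : ℝ) < (n : ℝ) ^ (30 * n) := by
    push_cast
    have hpos : (0 : ℝ) < (n : ℝ) ^ (30 * n) := pow_pos (by exact_mod_cast hn) _
    calc _ ≤ ∑ t ∈ Icc 1 R, (n : ℝ) ^ (30 * n) * (1 / 2) ^ t := by
          refine Finset.sum_le_sum fun t ht => ?_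
          have ht' : t ≤ R := (mem_Icc.1 ht).2
          rw [show 30 * n = 6 * t + 6 * (5 * n - t) by omega, pow_add]
          have h1 := mul_le_mul_of_nonneg_right
            (choose_mul_choose_mul_pow_le (n := n) (t := t) (by omega))
            (pow_nonneg (Nat.cast_nonneg (α := ℝ) n) (6 * (5 * n - t)))
          calc _ = _ := by ring
            _ ≤ _ := h1
            _ = _ := by ring
      _ = (n : ℝ) ^ (30 * n) * ∑ t ∈ Icc 1 R, (1 / 2) ^ t := by rw [Finset.mul_sum]
      _ < (n : ℝ) ^ (30 * n) * 1 := by gcongr; exact sum_Icc_half_pow_lt_one R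
      _ = _ := mul_one _
  exact absurd hle (not_le.2 (by exact_mod_cast hlt))

theorem vecMul_parityMatrix {n m : ℕ} (g : Fin m → Fin 2 → Fin 3 → Fin n) (t : Fin m → ZMod 2)
    (i : Fin n) : Matrix.vecMul t (parityMatrix g) i =
      (#{p ∈ ({j | t j ≠ 0} : Finset (Fin m)) ×ˢ (univ : Finset (Fin 2 × Fin 3)) | g p.1 p.2.1 p.2.2 = i} : ℕ) := by
  have h01 : ∀ a : ZMod 2, a ≠ 0 → a = 1 := by decide
  rw [Finset.card_filter, Nat.cast_sum, Finset.sum_product, Finset.sum_filter, Matrix.vecMul,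
    dotProduct]
  refine Finset.sum_congr rfl fun j _ => ?_
  by_cases h : t j = 0
  · simp [h]
  · rw [if_pos h, h01 _ h, one_mul, Fintype.sum_prod_type]
    simp [parityMatrix, Finset.sum_apply, Pi.single_apply, eq_comm]

theorem isSumExpanding_parityMatrix {n m R : ℕ} {g : Fin m → Fin 2 → Fin 3 → Fin n}
    (hg : ∀ T : Finset (Fin m), T.Nonempty → #T ≤ R →
      4 * #T < #(T.biUnion fun j => univ.image fun p : Fin 2 × Fin 3 => g j p.1 p.2)) :
    IsSumExpanding (parityMatrix g) R := by
  intro t ht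
  set T : Finset (Fin m) := {j | t j ≠ 0} with hT
  have htT : hammingNorm t = #T := by rw [hammingNorm, hT]
  set I := T.biUnion fun j => univ.image fun p : Fin 2 × Fin 3 => g j p.1 p.2 with hI
  set cnt : Fin n → ℕ := fun i =>
    #{p ∈ T ×ˢ (univ : Finset (Fin 2 × Fin 3)) | g p.1 p.2.1 p.2.2 = i} with hcnt
  rcases T.eq_empty_or_nonempty with h0 | hne
  · rw [htT, h0]; simp
  have hsum : ∑ i ∈ I, cnt i = 6 * #T := by
    rw [hcnt, ← Finset.card_eq_sum_card_fiberwise, card_product]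
    · simp [mul_comm]
    · intro p hp
      rw [mem_coe, mem_product] at hp
      exact mem_coe.2 (mem_biUnion.2 ⟨p.1, hp.1, mem_image.2 ⟨p.2, mem_univ _, rfl⟩⟩)
  have hnorm : ∑ i ∈ I, (if Matrix.vecMul t (parityMatrix g) i ≠ 0 then 1 else 0) ≤
      hammingNorm (Matrix.vecMul t (parityMatrix g)) := by
    rw [← Finset.card_filter, hammingNorm]
    refine Finset.card_le_card fun i hi => ?_
    rw [mem_filter] at hi ⊢
    exact ⟨mem_univ i, hi.2⟩
  have htwo : ∑ i ∈ I, 2 ≤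
      ∑ i ∈ I, (cnt i + if Matrix.vecMul t (parityMatrix g) i ≠ 0 then 1 else 0) := by
    refine Finset.sum_le_sum fun i hi => ?_
    have hpos : 0 < cnt i := by
      obtain ⟨j, hj, hi⟩ := mem_biUnion.1 hi
      obtain ⟨p, -, hp⟩ := mem_image.1 hi
      exact Finset.card_pos.2 ⟨(j, p), mem_filter.2 ⟨mem_product.2 ⟨hj, mem_univ p⟩, hp⟩⟩
    by_cases h1 : cnt i = 1
    · have hv : Matrix.vecMul t (parityMatrix g) i = (cnt i : ℕ) := vecMul_parityMatrix g t i
      rw [hv, h1, if_pos (by decide)]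
    · omega
  rw [Finset.sum_add_distrib, hsum, Finset.sum_const, smul_eq_mul] at htwo
  have hlt : 4 * #T < #I := hg T hne (htT ▸ ht)
  rw [htT]
  omega

end Counting

/-- integrality gap for 2-out-of-4-SAT-EQ. -/
theorem twooutoffour_sateq_integrality_gap :
    ∃ (δ c : ℝ) (K n₀ : ℕ), 0 < δ ∧ δ < 1 ∧ 0 < c ∧
      ∀ n : ℕ, n₀ ≤ n →
        ∃ (N : ℕ) (Φ : List (TFClause N)),
          N ≤ K * n ∧
          (∀ x : Fin N → ℝ, IsPM x → eval x (objPoly Φ) ≤ 1 - δ) ∧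
          ∃ E : MvPolynomial (Fin N) ℝ →ₗ[ℝ] ℝ,
            E 1 = 1 ∧
            (∀ p : MvPolynomial (Fin N) ℝ,
              p.totalDegree ≤ ⌈c * n⌉₊ / 2 → 0 ≤ E (p ^ 2)) ∧
            (∀ (i : Fin N) (q : MvPolynomial (Fin N) ℝ),
              q.totalDegree ≤ ⌈c * n⌉₊ - 2 → E ((X i ^ 2 - 1) * q) = 0) ∧
            E (objPoly Φ) = 1 ∧
            (∀ l₁ l₂ l₃ l₄ : Fin N × Bool, TFClause.four l₁ l₂ l₃ l₄ ∈ Φ →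
              ∀ p : MvPolynomial (Fin N) ℝ, (p.totalDegree : ℝ) ≤ c * n - 1 →
                E ((litPoly l₁ + litPoly l₂ + litPoly l₃ + litPoly l₄) * p) = 0) := by
  refine ⟨1 / 25, 1 / 480000, 31, 640000, by norm_num, by norm_num, by norm_num, fun n hn => ?_⟩
  have hn0 : 0 < n := by omega
  set d := ⌈(1 / 480000 : ℝ) * n⌉₊ / 2 with hd
  have hdn : 40000 * (2 * (6 * d + 1)) ≤ n := by
    have h1 := Nat.ceil_lt_add_one (show (0 : ℝ) ≤ 1 / 480000 * n by positivity)
    have h2 : (2 * d : ℕ) ≤ ⌈(1 / 480000 : ℝ) * n⌉₊ := Nat.mul_div_le _ 2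
    have h3 : ((2 * d : ℕ) : ℝ) < 1 / 480000 * n + 1 := lt_of_le_of_lt (by exact_mod_cast h2) h1
    have h4 : (640000 : ℝ) ≤ n := by exact_mod_cast hn
    have h5 : ((40000 * (2 * (6 * d + 1)) : ℕ) : ℝ) ≤ n := by
      push_cast at h3 ⊢
      linarith
    exact_mod_cast h5
  obtain ⟨G, hG⟩ := exists_expanding_families hn0 hdn
  set g : Fin (5 * n) → Fin 2 → Fin 3 → Fin n := fun j h k => G j (h, k)
  have hA : IsSumExpanding (parityMatrix g) (2 * (6 * d + 1)) := isSumExpanding_parityMatrix hG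
  obtain ⟨b, hb⟩ := exists_forall_le_hammingDist hn0 (parityMatrix g).mulVec
  set e := Fintype.equivFin (GadgetVar n (5 * n))
  refine ⟨_, parityInstance e g b, ?_, fun x hx => ?_, ?_⟩
  · simp only [GadgetVar, Fintype.card_sum, Fintype.card_prod, Fintype.card_fin]
    omega
  · refine (hx.eval_objPoly_parityInstance e g b hb (by omega)).trans (le_of_eq ?_)
    have : (n : ℝ) ≠ 0 := by exact_mod_cast hn0.ne'
    push_cast
    field_simp
    norm_num
  · refine ⟨derivedFunctional (parityMatrix g) b (6 * d + 1) ∘ₗ (gadgetEval e g).toLinearMap,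
      ?_, fun p hp => ?_, fun i q _ => ?_, ?_, fun l₁ l₂ l₃ l₄ hl p _ => ?_⟩
    · rw [LinearMap.comp_apply, AlgHom.toLinearMap_apply, map_one, AddMonoidAlgebra.one_def,
        derivedFunctional_single, hA.derivedSign_zero, mul_one]
    · rw [LinearMap.comp_apply, AlgHom.toLinearMap_apply, map_pow]
      exact hA.derivedFunctional_sq_nonneg (D := 3 * d) (by omega)
        (aeval_mem_fourierDegreeLE (fun i => gadgetValue_mem_fourierDegreeLE g _) hp)
    · have h0 : gadgetEval e g ((X i ^ 2 - 1) * q) = 0 := by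
        rw [map_mul, map_sub, map_pow, map_one, gadgetEval, aeval_X, gadgetValue_sq, sub_self,
          zero_mul]
      rw [LinearMap.comp_apply, AlgHom.toLinearMap_apply, h0, map_zero]
    · exact derivedFunctional_objPoly hA (by omega) (by omega)
    · rw [LinearMap.comp_apply, AlgHom.toLinearMap_apply, map_mul, gadgetEval_four hl, zero_mul,
        map_zero]
end

section
/- Satisfiability-test product identity: Let E be an ℝ-linear functional on ℝ[x₁,…,x_n] with E[1] = 1, and let L₁,…,L_m ∈ ℝ[x₁,…,x_n] be polynomials of total degree at most 1 such that E[L_r·q] = 0 for every r ∈ {1,…,m} and every polynomial q of total degree at most 2m − 1. Then E[ ∏_{r=1}^{m} (1 − L_r²/4) ] = 1. -/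
open MvPolynomial

theorem totalDegree_prod_one_sub_C_mul_sq_le {σ ι R : Type*} [CommRing R]
    (c : R) (L : ι → MvPolynomial σ R) (hL : ∀ r, (L r).totalDegree ≤ 1) (s : Finset ι) :
    (∏ r ∈ s, (1 - C c * (L r) ^ 2)).totalDegree ≤ 2 * s.card := by
  refine (totalDegree_finsetProd _ _).trans ?_
  have h : ∀ r ∈ s, (1 - C c * (L r) ^ 2).totalDegree ≤ 2 := by
    intro r _
    refine (totalDegree_sub _ _).trans (max_le (by simp) ?_)
    have h₁ := totalDegree_mul (C c) ((L r) ^ 2)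
    have h₂ := totalDegree_pow (L r) 2
    have h₃ := hL r
    rw [totalDegree_C] at h₁
    omega
  refine (Finset.sum_le_card_nsmul s _ 2 h).trans ?_
  rw [smul_eq_mul, mul_comm]

/-- satisfiability-test product identity. -/
theorem satisfiability_test_product_identity
    (n m : ℕ)
    (E : MvPolynomial (Fin n) ℝ →ₗ[ℝ] ℝ)
    (hE1 : E 1 = 1)
    (L : Fin m → MvPolynomial (Fin n) ℝ)
    (hLdeg : ∀ r, (L r).totalDegree ≤ 1)
    (hLE : ∀ (r : Fin m) (q : MvPolynomial (Fin n) ℝ),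
      q.totalDegree ≤ 2 * m - 1 → E (L r * q) = 0) :
    E (∏ r : Fin m, (1 - C (1 / 4) * (L r) ^ 2)) = 1 := by
  suffices h : ∀ s : Finset (Fin m), E (∏ r ∈ s, (1 - C (1 / 4) * (L r) ^ 2)) = 1 from h _
  intro s
  induction s using Finset.induction_on with
  | empty => simpa using hE1
  | insert a s ha ih =>
    have hP := totalDegree_prod_one_sub_C_mul_sq_le (1 / 4 : ℝ) L hLdeg s
    rw [Finset.prod_insert ha]
    set P := ∏ r ∈ s, (1 - C (1 / 4) * (L r) ^ 2)
    have hcard : s.card + 1 ≤ m := by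
      simpa [Finset.card_insert_of_notMem ha] using Finset.card_le_univ (insert a s)
    have hq : (C (1 / 4) * (L a * P)).totalDegree ≤ 2 * m - 1 := by
      have h₁ := totalDegree_mul (C (1 / 4)) (L a * P)
      have h₂ := totalDegree_mul (L a) P
      have h₃ := hLdeg a
      rw [totalDegree_C] at h₁
      omega
    have hsplit : (1 - C (1 / 4) * (L a) ^ 2) * P = P - L a * (C (1 / 4) * (L a * P)) := by ring
    rw [hsplit, map_sub, ih, hLE a _ hq, sub_zero]
end

section
/- Relation between h_Sep and the 2→4 norm: Let A be a real m×d matrix with entries A_{a,i}, and define M_{(i,j),(k,l)} = Σ_{a=1}^{m} A_{a,i}·A_{a,j}·A_{a,k}·A_{a,l}. Then the supremum over unit vectors x, y ∈ ℂ^d of Σ_{i,j,k,l} M_{(i,j),(k,l)}·conj(x_i)·x_j·conj(y_k)·y_l (a real number, equal to Σ_a |(Ax)_a|²·|(Ay)_a|²) equals ‖A‖_{2→4}⁴, where ‖A‖_{2→4} = sup { ‖Ax‖₄ : x ∈ ℝ^d, ‖x‖₂ = 1 } and ‖v‖₄ = (Σ_a |v_a|⁴)^{1/4}. -/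
section TwoToFour

variable {ι κ : Type*} [Fintype ι] [Fintype κ]

/-- A bound on `‖Ax‖₄⁴` over real unit vectors extends to all real vectors by homogeneity. -/
theorem sum_pow_four_le_of_unit_bound {A : ι → κ → ℝ} {K : ℝ}
    (hK : ∀ x : κ → ℝ, ∑ i, x i ^ 2 = 1 → ∑ a, (∑ i, A a i * x i) ^ 4 ≤ K) (x : κ → ℝ) :
    ∑ a, (∑ i, A a i * x i) ^ 4 ≤ K * (∑ i, x i ^ 2) ^ 2 := by
  rcases (Finset.sum_nonneg fun i _ => sq_nonneg (x i) : 0 ≤ ∑ i, x i ^ 2).eq_or_lt with h | h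
  · have hx : ∀ i, x i = 0 := fun i => by
      have := (Finset.sum_eq_zero_iff_of_nonneg fun i _ => sq_nonneg (x i)).1 h.symm i
        (Finset.mem_univ i)
      exact pow_eq_zero_iff two_ne_zero |>.1 this
    simp [hx]
  · set s := ∑ i, x i ^ 2 with hs
    have hr : √s ^ 2 = s := Real.sq_sqrt h.le
    have hr0 : √s ≠ 0 := (Real.sqrt_pos.2 h).ne'
    have hunit : ∑ i, (x i / √s) ^ 2 = 1 := by
      simp_rw [div_pow, ← Finset.sum_div, hr]
      exact div_self h.ne'
    have hbound := hK _ hunit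
    have hscale : ∑ a, (∑ i, A a i * (x i / √s)) ^ 4 = (∑ a, (∑ i, A a i * x i) ^ 4) / s ^ 2 := by
      have hr4 : √s ^ 4 = s ^ 2 := by rw [← hr, ← pow_mul, Real.sqrt_sq (Real.sqrt_nonneg s)]
      simp_rw [← mul_div_assoc, ← Finset.sum_div, div_pow, ← Finset.sum_div, hr4]
    rw [hscale, div_le_iff₀ (by positivity)] at hbound
    exact hbound

theorem normSq_sum_ofReal_mul (b : κ → ℝ) (x : κ → ℂ) :
    Complex.normSq (∑ i, (b i : ℂ) * x i) =
      (∑ i, b i * (x i).re) ^ 2 + (∑ i, b i * (x i).im) ^ 2 := by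
  simp [Complex.normSq_apply, Complex.re_sum, Complex.im_sum, sq]

/-- Complexification does not increase the `2→4` norm. -/
theorem sum_normSq_sq_le_of_unit_bound {A : ι → κ → ℝ} {K : ℝ} (hK0 : 0 ≤ K)
    (hK : ∀ x : κ → ℝ, ∑ i, x i ^ 2 = 1 → ∑ a, (∑ i, A a i * x i) ^ 4 ≤ K) (x : κ → ℂ) :
    ∑ a, Complex.normSq (∑ i, (A a i : ℂ) * x i) ^ 2 ≤ K * (∑ i, Complex.normSq (x i)) ^ 2 := by
  have hx : ∑ i, Complex.normSq (x i) = ∑ i, (x i).re ^ 2 + ∑ i, (x i).im ^ 2 := by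
    simp [Complex.normSq_apply, Finset.sum_add_distrib, sq]
  have hre := sum_pow_four_le_of_unit_bound hK fun i => (x i).re
  have him := sum_pow_four_le_of_unit_bound hK fun i => (x i).im
  simp_rw [normSq_sum_ofReal_mul, hx]
  set s := ∑ i, (x i).re ^ 2
  set t := ∑ i, (x i).im ^ 2
  have hs : 0 ≤ s := Finset.sum_nonneg fun i _ => sq_nonneg _
  have ht : 0 ≤ t := Finset.sum_nonneg fun i _ => sq_nonneg _
  set p : ι → ℝ := fun a => ∑ i, A a i * (x i).re
  set q : ι → ℝ := fun a => ∑ i, A a i * (x i).im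
  change ∑ a, p a ^ 4 ≤ _ at hre
  change ∑ a, q a ^ 4 ≤ _ at him
  change ∑ a, (p a ^ 2 + q a ^ 2) ^ 2 ≤ _
  have hpq : ∑ a, p a ^ 2 * q a ^ 2 ≤ K * (s * t) := by
    refine abs_le_of_sq_le_sq' ?_ (by positivity) |>.2
    calc (∑ a, p a ^ 2 * q a ^ 2) ^ 2 ≤ (∑ a, (p a ^ 2) ^ 2) * ∑ a, (q a ^ 2) ^ 2 :=
          Finset.sum_mul_sq_le_sq_mul_sq _ _ _
      _ = (∑ a, p a ^ 4) * ∑ a, q a ^ 4 := by simp_rw [← pow_mul]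
      _ ≤ (K * s ^ 2) * (K * t ^ 2) := by gcongr
      _ = (K * (s * t)) ^ 2 := by ring
  calc ∑ a, (p a ^ 2 + q a ^ 2) ^ 2
      = ∑ a, p a ^ 4 + 2 * ∑ a, p a ^ 2 * q a ^ 2 + ∑ a, q a ^ 4 := by
        rw [Finset.mul_sum, ← Finset.sum_add_distrib, ← Finset.sum_add_distrib]
        exact Finset.sum_congr rfl fun a _ => by ring
    _ ≤ K * s ^ 2 + 2 * (K * (s * t)) + K * t ^ 2 := by gcongr
    _ = K * (s + t) ^ 2 := by ring

theorem sum_normSq_mul_normSq_le_of_unit_bound {A : ι → κ → ℝ} {K : ℝ} (hK0 : 0 ≤ K)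
    (hK : ∀ x : κ → ℝ, ∑ i, x i ^ 2 = 1 → ∑ a, (∑ i, A a i * x i) ^ 4 ≤ K) {x y : κ → ℂ}
    (hx : ∑ i, Complex.normSq (x i) = 1) (hy : ∑ i, Complex.normSq (y i) = 1) :
    ∑ a, Complex.normSq (∑ i, (A a i : ℂ) * x i) * Complex.normSq (∑ i, (A a i : ℂ) * y i)
      ≤ K := by
  have h1 := sum_normSq_sq_le_of_unit_bound hK0 hK x
  have h2 := sum_normSq_sq_le_of_unit_bound hK0 hK y
  rw [hx] at h1
  rw [hy] at h2
  have h3 : 2 * ∑ a, Complex.normSq (∑ i, (A a i : ℂ) * x i) *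
        Complex.normSq (∑ i, (A a i : ℂ) * y i) ≤
      ∑ a, Complex.normSq (∑ i, (A a i : ℂ) * x i) ^ 2 +
        ∑ a, Complex.normSq (∑ i, (A a i : ℂ) * y i) ^ 2 := by
    rw [Finset.mul_sum, ← Finset.sum_add_distrib]
    refine Finset.sum_le_sum fun a _ => ?_
    rw [← mul_assoc]
    exact two_mul_le_add_sq _ _
  linarith

/-- The quartic form of `M` factors as `Σ_a |(Ax)_a|²·|(Ay)_a|²`. -/
theorem sum_quartic_eq_sum_normSq_mul_normSq (A : ι → κ → ℝ) (x y : κ → ℂ) :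
    ∑ i, ∑ j, ∑ k, ∑ l, ((∑ a, A a i * A a j * A a k * A a l : ℝ) : ℂ) *
        ((starRingEnd ℂ) (x i) * x j * (starRingEnd ℂ) (y k) * y l) =
      ((∑ a, Complex.normSq (∑ i, (A a i : ℂ) * x i) *
        Complex.normSq (∑ i, (A a i : ℂ) * y i) : ℝ) : ℂ) := by
  have expand : ∀ a, ((Complex.normSq (∑ i, (A a i : ℂ) * x i) *
      Complex.normSq (∑ i, (A a i : ℂ) * y i) : ℝ) : ℂ) =
      ∑ i, ∑ j, ∑ k, ∑ l, ((A a i * A a j * A a k * A a l : ℝ) : ℂ) *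
        ((starRingEnd ℂ) (x i) * x j * (starRingEnd ℂ) (y k) * y l) := fun a => by
    rw [Complex.ofReal_mul, Complex.normSq_eq_conj_mul_self, Complex.normSq_eq_conj_mul_self,
      map_sum, map_sum, Finset.sum_mul_sum, Finset.sum_mul_sum, Finset.sum_mul]
    refine Finset.sum_congr rfl fun i _ => ?_
    rw [Finset.sum_mul]
    refine Finset.sum_congr rfl fun j _ => ?_
    rw [Finset.mul_sum]
    refine Finset.sum_congr rfl fun k _ => ?_
    rw [Finset.mul_sum]
    refine Finset.sum_congr rfl fun l _ => ?_
    simp only [map_mul, Complex.conj_ofReal, Complex.ofReal_mul]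
    ring
  rw [Complex.ofReal_sum]
  simp_rw [expand, Complex.ofReal_sum, Finset.sum_mul]
  symm
  rw [Finset.sum_comm]
  refine Finset.sum_congr rfl fun i _ => ?_
  rw [Finset.sum_comm]
  refine Finset.sum_congr rfl fun j _ => ?_
  rw [Finset.sum_comm]
  refine Finset.sum_congr rfl fun k _ => ?_
  exact Finset.sum_comm

theorem sum_pow_four_le_of_sum_sq_eq_one (A : ι → κ → ℝ) {x : κ → ℝ} (hx : ∑ i, x i ^ 2 = 1) :
    ∑ a, (∑ i, A a i * x i) ^ 4 ≤ ∑ a, (∑ i, A a i ^ 2) ^ 2 := by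
  refine Finset.sum_le_sum fun a _ => ?_
  have h := Finset.sum_mul_sq_le_sq_mul_sq Finset.univ (A a) x
  rw [hx, mul_one] at h
  calc (∑ i, A a i * x i) ^ 4 = ((∑ i, A a i * x i) ^ 2) ^ 2 := by ring
    _ ≤ _ := by gcongr

end TwoToFour

/-- relation between `h_Sep` and the `2→4` norm.  For
`M_{(i,j),(k,l)} = Σ_a A_{a,i}·A_{a,j}·A_{a,k}·A_{a,l}`, the supremum over unit
complex vectors `x, y` of `Σ_{i,j,k,l} M_{(i,j),(k,l)}·conj(x_i)·x_j·conj(y_k)·y_l`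
equals `‖A‖_{2→4}⁴`. -/
theorem hSep_eq_twoToFour_norm_pow_four (m d : ℕ) (A : Fin m → Fin d → ℝ) :
    sSup { r : ℝ | ∃ x y : Fin d → ℂ,
        (∑ i, Complex.normSq (x i)) = 1 ∧ (∑ i, Complex.normSq (y i)) = 1 ∧
        (r : ℂ) = ∑ i, ∑ j, ∑ k, ∑ l,
          ((∑ a, A a i * A a j * A a k * A a l : ℝ) : ℂ) *
            ((starRingEnd ℂ) (x i) * x j * (starRingEnd ℂ) (y k) * y l) }
      =
    (sSup { t : ℝ | ∃ x : Fin d → ℝ, (∑ i, (x i) ^ 2) = 1 ∧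
        t = (∑ a, (∑ i, A a i * x i) ^ 4) ^ ((1 : ℝ) / 4) }) ^ 4 := by
  simp_rw [sum_quartic_eq_sum_normSq_mul_normSq, Complex.ofReal_inj]
  set S := { r : ℝ | ∃ x y : Fin d → ℂ,
    (∑ i, Complex.normSq (x i)) = 1 ∧ (∑ i, Complex.normSq (y i)) = 1 ∧
    r = ∑ a, Complex.normSq (∑ i, (A a i : ℂ) * x i) *
      Complex.normSq (∑ i, (A a i : ℂ) * y i) }
  set T := { t : ℝ | ∃ x : Fin d → ℝ, (∑ i, (x i) ^ 2) = 1 ∧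
    t = (∑ a, (∑ i, A a i * x i) ^ 4) ^ ((1 : ℝ) / 4) }
  have hF0 : ∀ x : Fin d → ℝ, 0 ≤ ∑ a, (∑ i, A a i * x i) ^ 4 := fun x =>
    Finset.sum_nonneg fun a _ => by positivity
  have hroot : ∀ {u : ℝ}, 0 ≤ u → (u ^ ((1 : ℝ) / 4)) ^ 4 = u := fun {u} hu => by
    rw [← Real.rpow_natCast, ← Real.rpow_mul hu]
    norm_num
  have hTbdd : BddAbove T := by
    refine ⟨(∑ a, (∑ i, A a i ^ 2) ^ 2) ^ ((1 : ℝ) / 4), ?_⟩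
    rintro t ⟨x, hx, rfl⟩
    exact Real.rpow_le_rpow (hF0 x) (sum_pow_four_le_of_sum_sq_eq_one A hx) (by norm_num)
  have hT0 : 0 ≤ sSup T := Real.sSup_nonneg fun t => by
    rintro ⟨x, -, rfl⟩
    exact Real.rpow_nonneg (hF0 x) _
  have hunit : ∀ x : Fin d → ℝ, ∑ i, x i ^ 2 = 1 →
      ∑ a, (∑ i, A a i * x i) ^ 4 ≤ sSup T ^ 4 := fun x hx => by
    rw [← hroot (hF0 x)]
    exact pow_le_pow_left₀ (Real.rpow_nonneg (hF0 x) _) (le_csSup hTbdd ⟨x, hx, rfl⟩) 4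
  have hS : ∀ r ∈ S, r ≤ sSup T ^ 4 := by
    rintro r ⟨x, y, hx, hy, rfl⟩
    exact sum_normSq_mul_normSq_le_of_unit_bound (by positivity) hunit hx hy
  have hS0 : 0 ≤ sSup S := Real.sSup_nonneg fun r => by
    rintro ⟨x, y, -, -, rfl⟩
    exact Finset.sum_nonneg fun a _ =>
      mul_nonneg (Complex.normSq_nonneg _) (Complex.normSq_nonneg _)
  refine le_antisymm (Real.sSup_le hS (by positivity)) ?_
  rw [← hroot hS0]
  refine pow_le_pow_left₀ hT0 (Real.sSup_le ?_ (Real.rpow_nonneg hS0 _)) 4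
  rintro t ⟨x, hx, rfl⟩
  refine Real.rpow_le_rpow (hF0 x) (le_csSup ⟨_, hS⟩ ?_) (by norm_num)
  have hx' : ∑ i, Complex.normSq (x i : ℂ) = 1 := by
    simpa [Complex.normSq_ofReal, ← sq] using hx
  refine ⟨fun i => x i, fun i => x i, hx', hx', Finset.sum_congr rfl fun a _ => ?_⟩
  rw [normSq_sum_ofReal_mul]
  simp only [Complex.ofReal_re, Complex.ofReal_im, mul_zero, Finset.sum_const_zero]
  ring
end

section
/- SoS integrality gap for the 2→4 norm (Corollary on the hypercube-to-sphere reduction): there exist constants C > 1, c > 0, e ∈ ℕ and d₀ such that for infinitely many dimensions d ≥ d₀ there exist m ∈ ℕ, a real m×d matrix A, and a degree-ℓ pseudo-expectation E over ℝ[x₁,…,x_d] with ℓ ≥ c·(log d)/(log log d)^e, such that E satisfies the unit-sphere constraint (E[(Σ_{i=1}^{d} x_i² − 1)·q] = 0 for every polynomial q of total degree at most ℓ − 2) and E[ Σ_{a=1}^{m} (Σ_{i=1}^{d} A_{a,i}·x_i)⁴ ] > C⁴ · sup { ‖Ax‖₄⁴ : x ∈ ℝ^d, ‖x‖₂ = 1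 }. In other words, the degree-ℓ sum-of-squares relaxation overestimates ‖A‖_{2→4}⁴ by more than the multiplicative factor C⁴. -/
open MvPolynomial

namespace SoSGap

/-! ### Positivity of multiplicative kernels -/

theorem sum_mul_kernel_nonneg {κ : Type*} (s : Finset κ) (K : κ → κ → ℝ) (p : κ → ℝ)
    (hdiag : ∀ u ∈ s, K u u = 1) (hsymm : ∀ u v, K u v = K v u)
    (hmul : ∀ u ∈ s, ∀ v ∈ s, ∀ w ∈ s, K u v ≠ 0 → K u w = K u v * K v w) :
    0 ≤ ∑ u ∈ s, ∑ v ∈ s, p u * p v * K u v := by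
  classical
  let N : κ → ℝ := fun u => ((s.filter fun w => K u w ≠ 0).card : ℝ)
  have hNpos : ∀ u ∈ s, 0 < N u := fun u hu =>
    Nat.cast_pos.2 (Finset.card_pos.2 ⟨u, by simp [hu, hdiag u hu]⟩)
  have hNeq : ∀ u ∈ s, ∀ w ∈ s, K u w ≠ 0 → N u = N w := fun u hu w hw h => by
    have : (s.filter fun x => K u x ≠ 0) = s.filter fun x => K w x ≠ 0 := by
      refine Finset.filter_congr fun x hx => ?_
      rw [hmul u hu w hw x hx h, mul_ne_zero_iff]
      exact ⟨fun h => h.2, fun h' => ⟨h, h'⟩⟩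
    simp only [N, this]
  have hdecomp : ∀ u ∈ s, ∀ v ∈ s, K u v = ∑ w ∈ s, (N w)⁻¹ * (K u w * K v w) := by
    intro u hu v hv
    have hterm : ∀ w ∈ s, (N w)⁻¹ * (K u w * K v w) =
        if K u w ≠ 0 then (N u)⁻¹ * K u v else 0 := by
      intro w hw
      split_ifs with h
      · rw [hNeq u hu w hw h, hmul u hu w hw v hv h, hsymm w v]
      · rw [not_not.1 h]; ring
    rw [Finset.sum_congr rfl hterm, ← Finset.sum_filter, Finset.sum_const, nsmul_eq_mul]
    change _ = N u * _
    rw [mul_inv_cancel_left₀ (hNpos u hu).ne']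
  have hsum : ∑ u ∈ s, ∑ v ∈ s, p u * p v * K u v =
      ∑ w ∈ s, (N w)⁻¹ * (∑ u ∈ s, p u * K u w) ^ 2 := by
    calc ∑ u ∈ s, ∑ v ∈ s, p u * p v * K u v
        = ∑ u ∈ s, ∑ v ∈ s, ∑ w ∈ s, (N w)⁻¹ * ((p u * K u w) * (p v * K v w)) := by
          refine Finset.sum_congr rfl fun u hu => Finset.sum_congr rfl fun v hv => ?_
          rw [hdecomp u hu v hv, Finset.mul_sum]
          exact Finset.sum_congr rfl fun w _ => by ring
      _ = ∑ w ∈ s, (N w)⁻¹ * (∑ u ∈ s, p u * K u w) ^ 2 := by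
          rw [Finset.sum_congr rfl fun u _ => Finset.sum_comm, Finset.sum_comm]
          refine Finset.sum_congr rfl fun w _ => ?_
          rw [sq, Finset.sum_mul_sum, Finset.mul_sum]
          exact Finset.sum_congr rfl fun u _ => by rw [Finset.mul_sum]
  rw [hsum]
  exact Finset.sum_nonneg fun w hw => mul_nonneg (inv_nonneg.2 (hNpos w hw).le) (sq_nonneg _)

/-! ### Functionals induced by a function on an abelian group -/

section Functional

variable {ι G : Type*} [AddCommGroup G]

/-- The linear functional sending a monomial `α` to `s ^ |α| * val (∑ i, α i • φ i)`. -/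
noncomputable def functional (val : G → ℝ) (φ : ι → G) (s : ℝ) : MvPolynomial ι ℝ →ₗ[ℝ] ℝ :=
  (basisMonomials ι ℝ).constr ℝ fun α => s ^ α.degree * val (Finsupp.weight φ α)

variable (val : G → ℝ) (φ : ι → G) (s : ℝ)

theorem functional_monomial (α : ι →₀ ℕ) (c : ℝ) :
    functional val φ s (monomial α c) = c * (s ^ α.degree * val (Finsupp.weight φ α)) := by
  have h : monomial α c = c • basisMonomials ι ℝ α := by
    simp [coe_basisMonomials, smul_monomial]
  rw [h, map_smul, functional, Module.Basis.constr_basis, smul_eq_mul]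

theorem functional_one (h0 : val 0 = 1) : functional val φ s 1 = 1 := by
  have := functional_monomial val φ s 0 1
  simpa [h0] using this

theorem functional_prod_X {κ : Type*} [Fintype κ] (f : κ → ι) :
    functional val φ s (∏ l, X (f l)) = s ^ Fintype.card κ * val (∑ l, φ (f l)) := by
  have h : (∏ l, X (f l) : MvPolynomial ι ℝ) = monomial (∑ l, Finsupp.single (f l) 1) 1 := by
    rw [monomial_sum_one]; rfl
  rw [h, functional_monomial]
  simp [Finsupp.weight_single]

theorem functional_linear_pow [Fintype ι] (a : ι → ℝ) (k : ℕ) :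
    functional val φ s ((∑ i, C (a i) * X i) ^ k) =
      ∑ f : Fin k → ι, (∏ l, a (f l)) * (s ^ k * val (∑ l, φ (f l))) := by
  rw [Fintype.sum_pow, map_sum]
  refine Finset.sum_congr rfl fun f _ => ?_
  rw [Finset.prod_mul_distrib, ← map_prod, ← smul_eq_C_mul, map_smul, functional_prod_X,
    Fintype.card_fin, smul_eq_mul]

theorem functional_X_sq_mul (hG : ∀ g : G, g + g = 0) (i : ι) (q : MvPolynomial ι ℝ) :
    functional val φ s (X i ^ 2 * q) = s ^ 2 * functional val φ s q := by
  induction q using MvPolynomial.induction_on' with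
  | monomial α c =>
    rw [X_pow_eq_monomial, monomial_mul, functional_monomial, functional_monomial, map_add,
      map_add, Finsupp.weight_single, two_nsmul, hG, Finsupp.degree_single, pow_add, zero_add]
    ring
  | add p q hp hq => rw [mul_add, map_add, map_add, hp, hq, mul_add]

theorem functional_sphere [Fintype ι] (hG : ∀ g : G, g + g = 0)
    (hs : Fintype.card ι * s ^ 2 = 1) (q : MvPolynomial ι ℝ) :
    functional val φ s (((∑ i, X i ^ 2) - 1) * q) = 0 := by
  rw [sub_mul, Finset.sum_mul, map_sub, map_sum,
    Finset.sum_congr rfl fun i _ => functional_X_sq_mul val φ s hG i q, Finset.sum_const, one_mul,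
    nsmul_eq_mul, ← mul_assoc, Finset.card_univ, hs, one_mul, sub_self]

theorem functional_sq_nonneg (D : ℕ)
    (hdiag : ∀ α : ι →₀ ℕ, α.degree ≤ D → val (Finsupp.weight φ α + Finsupp.weight φ α) = 1)
    (hmul : ∀ α β γ : ι →₀ ℕ, α.degree ≤ D → β.degree ≤ D → γ.degree ≤ D →
      val (Finsupp.weight φ α + Finsupp.weight φ β) ≠ 0 →
      val (Finsupp.weight φ α + Finsupp.weight φ γ) =
        val (Finsupp.weight φ α + Finsupp.weight φ β) *
          val (Finsupp.weight φ β + Finsupp.weight φ γ))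
    (p : MvPolynomial ι ℝ) (hp : p.totalDegree ≤ D) :
    0 ≤ functional val φ s (p ^ 2) := by
  have hdeg : ∀ α ∈ p.support, α.degree ≤ D := fun α hα =>
    (le_totalDegree hα).trans hp
  have h : functional val φ s (p ^ 2) = ∑ α ∈ p.support, ∑ β ∈ p.support,
      (p.coeff α * s ^ α.degree) * (p.coeff β * s ^ β.degree) *
        val (Finsupp.weight φ α + Finsupp.weight φ β) := by
    conv_lhs => rw [sq, p.as_sum, Finset.sum_mul_sum, map_sum]
    refine Finset.sum_congr rfl fun α _ => ?_
    rw [map_sum]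
    refine Finset.sum_congr rfl fun β _ => ?_
    rw [monomial_mul, functional_monomial, map_add, map_add, pow_add]
    ring
  rw [h]
  refine sum_mul_kernel_nonneg p.support
    (fun α β => val (Finsupp.weight φ α + Finsupp.weight φ β)) _ ?_ ?_ ?_
  · exact fun α hα => hdiag α (hdeg α hα)
  · exact fun α β => by rw [add_comm]
  · exact fun α hα β hβ γ hγ => hmul α β γ (hdeg α hα) (hdeg β hβ) (hdeg γ hγ)

theorem le_degree_of_subadditive (w : G → ℕ) (h0 : w 0 = 0) (hadd : ∀ g h, w (g + h) ≤ w g + w h)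
    (hφ : ∀ i, w (φ i) ≤ 1) (α : ι →₀ ℕ) : w (Finsupp.weight φ α) ≤ α.degree := by
  classical
  have hn : ∀ (n : ℕ) (i : ι), w (n • φ i) ≤ n := fun n i => by
    induction n with
    | zero => simp [h0]
    | succ n ih =>
      rw [succ_nsmul]
      exact (hadd _ _).trans (add_le_add ih (hφ i))
  induction α using Finsupp.induction_linear with
  | zero => simp [h0]
  | add f g hf hg =>
    rw [map_add, map_add]
    exact (hadd _ _).trans (add_le_add hf hg)
  | single i n => simpa [Finsupp.weight_single] using hn n i

end Functional

/-! ### The pseudo-expectation of a system of parity constraints -/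

section Parity

variable {M N : Type*} [Fintype M] [Fintype N]

theorem hammingNorm_add_le (F F' : M → ZMod 2) :
    hammingNorm (F + F') ≤ hammingNorm F + hammingNorm F' := by
  have h : -F + F' = F + F' := by
    rw [show -F = F from funext fun i => CharTwo.neg_eq (F i)]
  have := hammingDist_triangle F 0 F'
  rwa [hammingDist_zero_right, hammingDist_zero_left, hammingDist_eq_hammingNorm, h] at this

omit [Fintype M] in
theorem add_self_zmod (F : M → ZMod 2) : F + F = 0 :=
  funext fun i => CharTwo.add_self_eq_zero (F i)

open Classical in
/-- The value of the monomial with parity vector `T` that is forced by at most `ℓ` of the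
constraints `(∂ F, χ F)`, and `0` if there is none. -/
noncomputable def parityVal (del : (M → ZMod 2) →+ (N → ZMod 2)) (χ : (M → ZMod 2) → ℝ) (ℓ : ℕ)
    (T : N → ZMod 2) : ℝ :=
  if h : ∃ F, hammingNorm F ≤ ℓ ∧ del F = T then χ h.choose else 0

variable {del : (M → ZMod 2) →+ (N → ZMod 2)} {χ : (M → ZMod 2) → ℝ} {ℓ : ℕ}
  (hexp : ∀ F, hammingNorm F ≤ 2 * ℓ → hammingNorm F ≤ hammingNorm (del F))
include hexp

theorem parityVal_del {F : M → ZMod 2} (hF : hammingNorm F ≤ ℓ) :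
    parityVal del χ ℓ (del F) = χ F := by
  have h : ∃ F', hammingNorm F' ≤ ℓ ∧ del F' = del F := ⟨F, hF, rfl⟩
  rw [parityVal, dif_pos h]
  congr 1
  have h1 := hexp (h.choose + F) <|
    (hammingNorm_add_le _ _).trans (by have := h.choose_spec.1; omega)
  rw [map_add, h.choose_spec.2, add_self_zmod, hammingNorm_zero, Nat.le_zero,
    hammingNorm_eq_zero] at h1
  rw [← add_right_cancel_iff (a := F), h1, add_self_zmod]

theorem parityVal_zero (h1 : χ 0 = 1) : parityVal del χ ℓ 0 = 1 := by
  rw [← map_zero del, parityVal_del hexp (by simp), h1]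

theorem parityVal_mul (hχ : ∀ F F', χ (F + F') = χ F * χ F') {U V W : N → ZMod 2}
    (hVW : hammingNorm (V + W) ≤ ℓ) (hUW : hammingNorm (U + W) ≤ ℓ)
    (hne : parityVal del χ ℓ (U + V) ≠ 0) :
    parityVal del χ ℓ (U + W) = parityVal del χ ℓ (U + V) * parityVal del χ ℓ (V + W) := by
  have hclosed : ∀ F F' T, hammingNorm F ≤ ℓ → hammingNorm F' ≤ ℓ → hammingNorm T ≤ ℓ →
      del F + del F' = T → hammingNorm (F + F') ≤ ℓ ∧ del (F + F') = T := by
    intro F F' T hF hF' hT h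
    have hd : del (F + F') = T := by rw [map_add, h]
    refine ⟨?_, hd⟩
    have := hexp (F + F') ((hammingNorm_add_le _ _).trans (by omega))
    rw [hd] at this
    exact this.trans hT
  by_cases hU : ∃ F, hammingNorm F ≤ ℓ ∧ del F = U + V
  swap
  · exact absurd (dif_neg hU) hne
  obtain ⟨F, hF, hFd⟩ := hU
  by_cases hV : ∃ F, hammingNorm F ≤ ℓ ∧ del F = V + W
  · obtain ⟨F', hF', hFd'⟩ := hV
    obtain ⟨h1, h2⟩ := hclosed F F' (U + W) hF hF' hUW (by
      rw [hFd, hFd', add_assoc, ← add_assoc V, add_self_zmod, zero_add])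
    rw [← hFd, ← hFd', ← h2, parityVal_del hexp hF, parityVal_del hexp hF', parityVal_del hexp h1,
      hχ]
  · have hV0 : parityVal del χ ℓ (V + W) = 0 := dif_neg hV
    rw [hV0, mul_zero]
    refine dif_neg fun ⟨F', hF', hFd'⟩ => hV ⟨F + F', hclosed F F' _ hF hF' hVW ?_⟩
    rw [hFd, hFd', add_comm U, add_assoc, ← add_assoc U, add_self_zmod, zero_add]

/-- Independent copies of the parity functional give a pseudo-expectation. -/
theorem functional_parity_sq_nonneg {ι κ : Type*} [Fintype κ] (h1 : χ 0 = 1)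
    (hχ : ∀ F F', χ (F + F') = χ F * χ F') (φ : ι → κ → N → ZMod 2)
    (hφ : ∀ i j, hammingNorm (φ i j) ≤ 1) (s : ℝ) (p : MvPolynomial ι ℝ)
    (hp : p.totalDegree ≤ ℓ / 2) :
    0 ≤ functional (fun T : κ → N → ZMod 2 => ∏ j, parityVal del χ ℓ (T j)) φ s (p ^ 2) := by
  have hsmall : ∀ α : ι →₀ ℕ, α.degree ≤ ℓ / 2 → ∀ j,
      hammingNorm (Finsupp.weight φ α j) ≤ ℓ / 2 := fun α hα j =>
    (le_degree_of_subadditive φ (fun T => hammingNorm (T j)) hammingNorm_zero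
      (fun _ _ => hammingNorm_add_le _ _) (fun i => hφ i j) α).trans hα
  have hadd : ∀ α β : ι →₀ ℕ, α.degree ≤ ℓ / 2 → β.degree ≤ ℓ / 2 → ∀ j,
      hammingNorm (Finsupp.weight φ α j + Finsupp.weight φ β j) ≤ ℓ := fun α β hα hβ j =>
    (hammingNorm_add_le _ _).trans
      ((add_le_add (hsmall α hα j) (hsmall β hβ j)).trans (by omega))
  refine functional_sq_nonneg _ φ s (ℓ / 2) (fun α _ => ?_)
    (fun α β γ _ hβ hγ hne => ?_) p hp
  · refine Finset.prod_eq_one fun j _ => ?_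
    rw [Pi.add_apply, add_self_zmod, parityVal_zero hexp h1]
  · rw [← Finset.prod_mul_distrib]
    refine Finset.prod_congr rfl fun j _ => ?_
    exact parityVal_mul hexp hχ (hadd _ _ hβ hγ j) (hadd _ _ ‹_› hγ j)
      (Finset.prod_ne_zero_iff.1 hne j (Finset.mem_univ j))

end Parity

/-! ### Tensor powers of a matrix -/

section Tensor

variable {ι R : Type*} [Fintype ι] [Fintype R]

theorem tensor_step {ι' R' : Type*} [Fintype ι'] [Fintype R'] {A : R → ι → ℝ} {B : R' → ι' → ℝ}
    {P Q : ℝ} (hP : 0 ≤ P) (hQ : 0 ≤ Q)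
    (hA : ∀ x : ι → ℝ, ∑ a, (∑ i, A a i * x i) ^ 4 ≤ P * (∑ i, x i ^ 2) ^ 2)
    (hB : ∀ x : ι' → ℝ, ∑ a, (∑ i, B a i * x i) ^ 4 ≤ Q * (∑ i, x i ^ 2) ^ 2)
    (x : ι → ι' → ℝ) :
    ∑ a, ∑ b, (∑ i, A a i * ∑ j, B b j * x i j) ^ 4 ≤ P * Q * (∑ i, ∑ j, x i j ^ 2) ^ 2 := by
  set u : R' → ι → ℝ := fun b i => ∑ j, B b j * x i j
  have hcs : ∀ i i', ∑ b, u b i ^ 2 * u b i' ^ 2 ≤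
      Q * ((∑ j, x i j ^ 2) * ∑ j, x i' j ^ 2) := fun i i' => by
    refine abs_le_of_sq_le_sq' ?_ (by positivity) |>.2
    calc (∑ b, u b i ^ 2 * u b i' ^ 2) ^ 2
        ≤ (∑ b, (u b i ^ 2) ^ 2) * ∑ b, (u b i' ^ 2) ^ 2 :=
          Finset.sum_mul_sq_le_sq_mul_sq _ _ _
      _ = (∑ b, u b i ^ 4) * ∑ b, u b i' ^ 4 := by simp only [← pow_mul]
      _ ≤ (Q * (∑ j, x i j ^ 2) ^ 2) * (Q * (∑ j, x i' j ^ 2) ^ 2) :=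
          mul_le_mul (hB _) (hB _) (by positivity) (by positivity)
      _ = _ := by ring
  calc ∑ a, ∑ b, (∑ i, A a i * u b i) ^ 4
      = ∑ b, ∑ a, (∑ i, A a i * u b i) ^ 4 := Finset.sum_comm
    _ ≤ ∑ b, P * (∑ i, u b i ^ 2) ^ 2 := Finset.sum_le_sum fun b _ => hA _
    _ = P * ∑ i, ∑ i', ∑ b, u b i ^ 2 * u b i' ^ 2 := by
        rw [← Finset.mul_sum, Finset.sum_congr rfl fun i _ => Finset.sum_comm,
          Finset.sum_comm]
        simp_rw [sq (∑ i, _), Finset.sum_mul_sum]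
    _ ≤ P * ∑ i, ∑ i', Q * ((∑ j, x i j ^ 2) * ∑ j, x i' j ^ 2) := by
        gcongr
        exact hcs _ _
    _ = _ := by
        simp_rw [← Finset.mul_sum, ← Finset.sum_mul]
        ring

theorem tensor_pow_bound {A : R → ι → ℝ} {P : ℝ} (hP : 0 ≤ P)
    (hA : ∀ x : ι → ℝ, ∑ a, (∑ i, A a i * x i) ^ 4 ≤ P * (∑ i, x i ^ 2) ^ 2) (k : ℕ)
    (x : (Fin k → ι) → ℝ) :
    ∑ a : Fin k → R, (∑ I : Fin k → ι, (∏ j, A (a j) (I j)) * x I) ^ 4 ≤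
      P ^ k * (∑ I, x I ^ 2) ^ 2 := by
  induction k with
  | zero => simp [← pow_mul]
  | succ k ih =>
    have h := tensor_step hP (pow_nonneg hP k) hA ih fun i I => x (Fin.cons i I)
    have hι : ∀ f : (Fin (k + 1) → ι) → ℝ, ∑ I, f I = ∑ i, ∑ I : Fin k → ι, f (Fin.cons i I) :=
      fun f => by
        rw [← (Fin.consEquiv fun _ => ι).sum_comp, Fintype.sum_prod_type]; rfl
    have hR : ∀ f : (Fin (k + 1) → R) → ℝ, ∑ I, f I = ∑ i, ∑ I : Fin k → R, f (Fin.cons i I) :=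
      fun f => by
        rw [← (Fin.consEquiv fun _ => R).sum_comp, Fintype.sum_prod_type]; rfl
    rw [hR, hι, pow_succ']
    convert h using 7 with a _ b _ i
    rw [hι]
    simp [Fin.prod_univ_succ, Finset.mul_sum, mul_assoc]

theorem functional_tensor_pow {G κ μ : Type*} [AddCommGroup G] [Fintype κ] [Fintype μ]
    (A : R → ι → ℝ) (val : G → ℝ) (φ : ι → G) (s : ℝ) (k : ℕ)
    (ε : κ ≃ (Fin k → ι)) (ρ : μ ≃ (Fin k → R)) :
    functional (fun T : Fin k → G => ∏ j, val (T j)) (fun i j => φ (ε i j)) (s ^ k)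
        (∑ a, (∑ i, C (∏ j, A (ρ a j) (ε i j)) * X i) ^ 4) =
      functional val φ s (∑ a, (∑ i, C (A a i) * X i) ^ 4) ^ k := by
  simp_rw [map_sum, functional_linear_pow, Fintype.sum_pow]
  rw [← ρ.sum_comp]
  refine Finset.sum_congr rfl fun a _ => ?_
  rw [Finset.prod_univ_sum, Fintype.piFinset_univ,
    ← ((Equiv.piCongrRight fun _ : Fin 4 => ε).trans (Equiv.piComm _)).sum_comp]
  refine Finset.sum_congr rfl fun f _ => ?_
  rw [Finset.prod_comm, Finset.prod_mul_distrib, Finset.prod_mul_distrib, Finset.prod_const,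
    Finset.card_univ, Fintype.card_fin, pow_right_comm]
  simp [Function.swap]

end Tensor

/-! ### Parity constraints on four variables and their quartic form -/

/-- The sign of a residue modulo two. -/
noncomputable def sgn (z : ZMod 2) : ℝ := if z = 0 then 1 else -1

@[simp] theorem sgn_zero : sgn 0 = 1 := if_pos rfl

@[simp] theorem sgn_one : sgn 1 = -1 := if_neg one_ne_zero

theorem sum_zmod_two {α : Type*} [AddCommMonoid α] (f : ZMod 2 → α) : ∑ z, f z = f 0 + f 1 :=
  Fin.sum_univ_two f

theorem zmod_two_cases (z : ZMod 2) : z = 0 ∨ z = 1 := by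
  revert z; decide

theorem sgn_sq (z : ZMod 2) : sgn z ^ 2 = 1 := by
  rcases zmod_two_cases z with rfl | rfl <;> simp

theorem sgn_add (z w : ZMod 2) : sgn (z + w) = sgn z * sgn w := by
  rcases zmod_two_cases z with rfl | rfl <;> rcases zmod_two_cases w with rfl | rfl <;>
    simp [CharTwo.add_self_eq_zero]

theorem sgn_sum {κ : Type*} (s : Finset κ) (z : κ → ZMod 2) :
    sgn (∑ i ∈ s, z i) = ∏ i ∈ s, sgn (z i) := by
  classical
  induction s using Finset.induction_on with
  | empty => simp
  | insert a s ha ih => rw [Finset.sum_insert ha, Finset.prod_insert ha, sgn_add, ih]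

/-- The defect of the constraint `b * u 0 * u 1 * u 2 * u 3 = 1` at `u`. -/
def defect {R : Type*} [CommRing R] (b : R) (u : Fin 4 → R) : R :=
  72 * ∑ j, u j ^ 4 - 12 * (∑ j, u j ^ 2) ^ 2 - 96 * (b * ∏ j, u j)

theorem map_defect {R S : Type*} [CommRing R] [CommRing S] (f : R →+* S) (b : R) (u : Fin 4 → R) :
    f (defect b u) = defect (f b) fun j => f (u j) := by
  simp only [defect, map_sub, map_mul, map_pow, map_sum, map_prod, map_ofNat]

theorem defect_nonneg {b : ℝ} (hb : b ^ 2 = 1) (u : Fin 4 → ℝ) : 0 ≤ defect b u := by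
  have h : defect b u = 12 * ((u 0 ^ 2 - u 1 ^ 2) ^ 2 + (u 0 ^ 2 - u 2 ^ 2) ^ 2 +
      (u 0 ^ 2 - u 3 ^ 2) ^ 2 + (u 1 ^ 2 - u 2 ^ 2) ^ 2 + (u 1 ^ 2 - u 3 ^ 2) ^ 2 +
      (u 2 ^ 2 - u 3 ^ 2) ^ 2) + 24 * ((u 0 ^ 2 - u 1 ^ 2) ^ 2 + (u 2 ^ 2 - u 3 ^ 2) ^ 2 +
      2 * (u 0 * u 1 - b * (u 2 * u 3)) ^ 2) := by
    simp only [defect, Fin.sum_univ_four, Fin.prod_univ_four]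
    linear_combination (-48 * (u 2 * u 3) ^ 2) * hb
  rw [h]
  positivity

theorem le_defect {b : ℝ} {u : Fin 4 → ℝ} (h : b * ∏ j, u j ≤ 0) :
    24 * ∑ j, u j ^ 4 ≤ defect b u := by
  have h2 : (∑ j, u j ^ 2) ^ 2 ≤ 4 * ∑ j, u j ^ 4 := by
    have := sq_sum_le_card_mul_sum_sq (s := Finset.univ) (f := fun j => u j ^ 2)
    simpa [← pow_mul] using this
  rw [defect]
  linarith

/-- The coefficients of the linear form of index `p` in the quartic form of a constraint. -/
noncomputable def pattern (b : ℝ) (p : ZMod 2 × ZMod 2) : Fin 4 → ℝ :=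
  ![1, sgn p.1, sgn p.2, b * (sgn p.1 * sgn p.2)]

theorem sum_pattern {b : ℝ} (hb : b ^ 2 = 1) (u : Fin 4 → ℝ) :
    ∑ p, (∑ j, pattern b p j * u j) ^ 4 = 64 * ∑ j, u j ^ 4 - defect b u := by
  rw [Fintype.sum_prod_type]
  simp only [sum_zmod_two, pattern, Fin.sum_univ_four, defect, Fin.prod_univ_four, sgn_zero,
    sgn_one, Matrix.cons_val]
  linear_combination (4 * u 3 ^ 4 * (b ^ 2 + 1) +
    24 * u 3 ^ 2 * (u 0 ^ 2 + u 1 ^ 2 + u 2 ^ 2) + 0 * b) * hb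

theorem sum_sgn_pow_four {N : Type*} [Fintype N] [DecidableEq N] (x : N → ℝ) :
    ∑ σ : N → ZMod 2, (∑ i, sgn (σ i) * x i) ^ 4 =
      2 ^ Fintype.card N * (3 * (∑ i, x i ^ 2) ^ 2 - 2 * ∑ i, x i ^ 4) := by
  have key : ∀ (n : ℕ) (x : Fin n → ℝ) (t : ℝ),
      ∑ σ : Fin n → ZMod 2, (t + ∑ i, sgn (σ i) * x i) ^ 4 =
        2 ^ n * (t ^ 4 + 6 * t ^ 2 * (∑ i, x i ^ 2) +
          3 * (∑ i, x i ^ 2) ^ 2 - 2 * ∑ i, x i ^ 4) := by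
    intro n
    induction n with
    | zero => simp
    | succ n ih =>
      intro x t
      rw [← (Fin.consEquiv fun _ => ZMod 2).sum_comp, Fintype.sum_prod_type, sum_zmod_two]
      simp only [Fin.consEquiv, Equiv.coe_fn_mk, Fin.sum_univ_succ, Fin.cons_zero, Fin.cons_succ,
        ← add_assoc, ih, sgn_zero, sgn_one]
      ring
  let e := Fintype.equivFin N
  have h := key (Fintype.card N) (fun i => x (e.symm i)) 0
  rw [← (e.arrowCongr (Equiv.refl (ZMod 2))).sum_comp] at h
  rw [e.symm.sum_comp fun i => x i ^ 2, e.symm.sum_comp fun i => x i ^ 4] at h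
  convert h using 2 with σ
  · rw [zero_add, ← e.symm.sum_comp]
    simp
  · ring

section Instance

variable {M N : Type*} [Fintype M] [Fintype N] [DecidableEq N]

/-- The rows of the matrix attached to the constraints `sgn (β c) * ∏ j, x (v c j) = 1`. -/
noncomputable def baseRow (v : M → Fin 4 → N) (β : M → ZMod 2) :
    (M × (ZMod 2 × ZMod 2) × (N → ZMod 2)) ⊕ (N → ZMod 2) → N → ℝ
  | .inl r => fun i => ∑ j, pattern (sgn (β r.1)) r.2.1 j * if v r.1 j = i then 1 else 0
  | .inr σ => fun i => 5 * sgn (σ i)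

variable {v : M → Fin 4 → N} (hreg : ∀ h : N → ℝ, ∑ c, ∑ j, h (v c j) = 8 * ∑ i, h i)
  (β : M → ZMod 2)
include hreg

theorem sum_baseRow (x : N → ℝ) :
    ∑ a, (∑ i, baseRow v β a i * x i) ^ 4 = 2 ^ Fintype.card N *
      (1875 * (∑ i, x i ^ 2) ^ 2 - 738 * ∑ i, x i ^ 4 -
        ∑ c, defect (sgn (β c)) fun j => x (v c j)) := by
  have h1 : ∀ (c : M) (p : ZMod 2 × ZMod 2),
      ∑ i, (∑ j, pattern (sgn (β c)) p j * if v c j = i then 1 else 0) * x i =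
        ∑ j, pattern (sgn (β c)) p j * x (v c j) := fun c p => by
    simp_rw [Finset.sum_mul]
    rw [Finset.sum_comm]
    simp
  have h2 : ∀ σ : N → ZMod 2, ∑ i, 5 * sgn (σ i) * x i = 5 * ∑ i, sgn (σ i) * x i := fun σ => by
    simp_rw [Finset.mul_sum, mul_assoc]
  simp only [Fintype.sum_sum_type, baseRow, h1, h2, mul_pow,
    ← Finset.mul_sum, sum_sgn_pow_four]
  rw [Fintype.sum_prod_type]
  simp only [Fintype.sum_prod_type (α₁ := ZMod 2 × ZMod 2), Finset.sum_const, ← Finset.smul_sum,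
    sum_pattern (sgn_sq _), Finset.sum_sub_distrib, ← Finset.mul_sum]
  rw [hreg fun i => x i ^ 4, Finset.card_univ, Fintype.card_fun, ZMod.card, nsmul_eq_mul]
  push_cast
  ring

theorem sum_baseRow_le (hN : 0 < Fintype.card N)
    (hsat : ∀ z : N → ZMod 2,
      Fintype.card N ≤ 8 * (Finset.univ.filter fun c => ∑ j, z (v c j) ≠ β c).card)
    (x : N → ℝ) :
    ∑ a, (∑ i, baseRow v β a i * x i) ^ 4 ≤
      2 ^ Fintype.card N * (1875 - 744 / Fintype.card N) * (∑ i, x i ^ 2) ^ 2 := by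
  rw [sum_baseRow hreg]
  set S := ∑ i, x i ^ 2
  set n : ℝ := (Fintype.card N : ℝ)
  have hn : 0 < n := Nat.cast_pos.2 hN
  set t : ℝ := S / n
  have hnt : n * t = S := mul_div_cancel₀ _ hn.ne'
  set dev : N → ℝ := fun i => (x i ^ 2 - t) ^ 2
  have hx4 : ∑ i, x i ^ 4 = ∑ i, dev i + t * S := by
    have : ∀ i, x i ^ 4 = dev i + (2 * t * x i ^ 2 - t ^ 2) := fun i => by
      simp only [dev]; ring
    rw [Finset.sum_congr rfl fun i _ => this i, Finset.sum_add_distrib, Finset.sum_sub_distrib,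
      ← Finset.mul_sum, Finset.sum_const, Finset.card_univ, nsmul_eq_mul]
    linear_combination -t * hnt
  let z : N → ZMod 2 := fun i => if x i < 0 then 1 else 0
  have hz : ∀ i, x i = sgn (z i) * |x i| := fun i => by
    by_cases h : x i < 0
    · simp [z, h, abs_of_neg h]
    · simp [z, h, abs_of_nonneg (not_lt.1 h)]
  set U := Finset.univ.filter fun c => ∑ j, z (v c j) ≠ β c
  have hU : n ≤ 8 * (U.card : ℝ) := by
    have h := (Nat.cast_le (α := ℝ)).2 (hsat z)
    rwa [Nat.cast_mul, Nat.cast_ofNat] at h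
  have hunsat : ∀ c ∈ U, 48 * t ^ 2 - 24 * ∑ j, dev (v c j) ≤
      defect (sgn (β c)) fun j => x (v c j) := by
    intro c hc
    have hprod : sgn (β c) * ∏ j, x (v c j) ≤ 0 := by
      have hne : ∑ j, z (v c j) + β c = 1 := by
        have hc' : ∑ j, z (v c j) ≠ β c := (Finset.mem_filter.1 hc).2
        generalize ∑ j, z (v c j) = a at hc'
        generalize β c = b at hc'
        revert a b; decide
      have : sgn (β c) * ∏ j, x (v c j) = -∏ j, |x (v c j)| := by
        rw [Finset.prod_congr rfl fun j _ => hz (v c j), Finset.prod_mul_distrib, ← sgn_sum,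
          ← mul_assoc, ← sgn_add, add_comm, hne, sgn_one, neg_one_mul]
      rw [this]
      exact neg_nonpos.2 (Finset.prod_nonneg fun j _ => abs_nonneg _)
    refine le_trans ?_ (le_defect hprod)
    have hj : ∀ j, t ^ 2 / 2 - dev (v c j) ≤ x (v c j) ^ 4 := fun j => by
      simp only [dev]
      nlinarith [sq_nonneg (2 * x (v c j) ^ 2 - t)]
    have := Finset.sum_le_sum fun j (_ : j ∈ Finset.univ) => hj j
    rw [Finset.sum_sub_distrib, Finset.sum_const, Finset.card_univ, Fintype.card_fin,
      nsmul_eq_mul] at this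
    push_cast at this
    linarith
  have hdef : 48 * t ^ 2 * U.card - 192 * ∑ i, dev i ≤
      ∑ c, defect (sgn (β c)) fun j => x (v c j) := by
    calc 48 * t ^ 2 * U.card - 192 * ∑ i, dev i
        = 48 * t ^ 2 * U.card - 24 * ∑ c, ∑ j, dev (v c j) := by rw [hreg dev]; ring
      _ ≤ 48 * t ^ 2 * U.card - 24 * ∑ c ∈ U, ∑ j, dev (v c j) := by
          refine sub_le_sub_left (mul_le_mul_of_nonneg_left ?_ (by norm_num)) _
          exact Finset.sum_le_univ_sum_of_nonneg fun c =>
            Finset.sum_nonneg fun j _ => sq_nonneg _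
      _ = ∑ c ∈ U, (48 * t ^ 2 - 24 * ∑ j, dev (v c j)) := by
          rw [Finset.sum_sub_distrib, Finset.sum_const, nsmul_eq_mul, Finset.mul_sum]; ring
      _ ≤ ∑ c ∈ U, defect (sgn (β c)) fun j => x (v c j) := Finset.sum_le_sum hunsat
      _ ≤ _ := Finset.sum_le_univ_sum_of_nonneg fun c => defect_nonneg (sgn_sq _) _
  have hdev : 0 ≤ ∑ i, dev i := Finset.sum_nonneg fun i _ => sq_nonneg _
  have hS : 744 / n * S ^ 2 = 744 * (t * S) := by simp only [t]; ring
  have hU' : 6 * (t * S) ≤ 48 * t ^ 2 * U.card := by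
    rw [← hnt]
    nlinarith [mul_le_mul_of_nonneg_left hU (sq_nonneg t)]
  rw [mul_assoc]
  gcongr
  rw [sub_mul, hS, hx4]
  linarith

omit hreg in
/-- The boundary of a set of constraints: the sum modulo two of their supports. -/
def boundary (v : M → Fin 4 → N) : (M → ZMod 2) →+ (N → ZMod 2) where
  toFun F i := ∑ c, ∑ j, if v c j = i then F c else 0
  map_zero' := by ext; simp
  map_add' F F' := by
    ext i
    simp only [Pi.add_apply, ← Finset.sum_add_distrib]
    refine Finset.sum_congr rfl fun c _ => Finset.sum_congr rfl fun j _ => ?_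
    split_ifs <;> simp

omit hreg [Fintype N] in
theorem boundary_single [DecidableEq M] (v : M → Fin 4 → N) (c : M) :
    boundary v (Pi.single c 1) = ∑ j, Pi.single (v c j) 1 := by
  ext i
  simp only [boundary, AddMonoidHom.coe_mk, ZeroHom.coe_mk, Finset.sum_apply, Pi.single_apply]
  rw [Finset.sum_eq_single c (fun c' _ h => by simp [h]) (by simp)]
  simp [eq_comm]

omit [Fintype N] [DecidableEq N] hreg in
theorem sgn_sum_mul_add (F F' : M → ZMod 2) :
    sgn (∑ c, β c * (F + F') c) = sgn (∑ c, β c * F c) * sgn (∑ c, β c * F' c) := by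
  simp only [Pi.add_apply, mul_add, Finset.sum_add_distrib, sgn_add]

theorem functional_sum_baseRow [DecidableEq M] {ℓ : ℕ} (hℓ : 1 ≤ ℓ)
    (hexp : ∀ F, hammingNorm F ≤ 2 * ℓ → hammingNorm F ≤ hammingNorm (boundary v F))
    {s : ℝ} (hs : Fintype.card N * s ^ 2 = 1) :
    functional (parityVal (boundary v) (fun F => sgn (∑ c, β c * F c)) ℓ)
        (fun i => Pi.single i 1) s (∑ a, (∑ i, C (baseRow v β a i) * X i) ^ 4) =
      2 ^ Fintype.card N * (1875 - 738 / Fintype.card N) := by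
  set χ : (M → ZMod 2) → ℝ := fun F => sgn (∑ c, β c * F c)
  set E := functional (parityVal (boundary v) χ ℓ) (fun i : N => Pi.single i 1) s
  have hpoly : (∑ a, (∑ i, C (baseRow v β a i) * X i) ^ 4 : MvPolynomial N ℝ) =
      C (2 ^ Fintype.card N) * (C 1875 * (∑ i, X i ^ 2) ^ 2 - C 738 * ∑ i, X i ^ 4 -
        ∑ c, defect (C (sgn (β c))) fun j => X (v c j)) := by
    refine MvPolynomial.funext fun x => ?_
    have := sum_baseRow hreg β x
    simpa [map_defect] using this
  have h1 : E 1 = 1 := functional_one _ _ _ (parityVal_zero hexp (by simp [χ]))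
  have hG : ∀ g : N → ZMod 2, g + g = 0 := add_self_zmod
  have hX : ∀ i q, E (X i ^ 2 * q) = s ^ 2 * E q := functional_X_sq_mul _ _ _ hG
  have hXX : ∀ i j, E (X i ^ 2 * X j ^ 2) = s ^ 4 := fun i j => by
    rw [hX, ← mul_one (X j ^ 2), hX, h1]; ring
  have hX4 : ∀ i, E (X i ^ 4) = s ^ 4 := fun i => by
    rw [← hXX i i]; ring_nf
  have hsq : E ((∑ i, X i ^ 2) ^ 2) = 1 := by
    have h0 := functional_sphere (parityVal (boundary v) χ ℓ) (fun i : N => Pi.single i 1) s hG hs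
      (∑ i, X i ^ 2 + 1)
    change E _ = 0 at h0
    rw [← h1, ← sub_eq_zero, ← map_sub, ← h0]
    ring_nf
  have hdef : ∀ c, E (defect (C (sgn (β c))) fun j => X (v c j)) = 0 := fun c => by
    have hprod : E (∏ j, X (v c j)) = s ^ 4 * sgn (β c) := by
      have hnorm : hammingNorm (Pi.single c 1 : M → ZMod 2) ≤ ℓ := by
        refine le_trans ?_ hℓ
        simp [hammingNorm, Pi.single_apply, Finset.filter_eq']
      simp only [E]
      rw [functional_prod_X, ← boundary_single, parityVal_del hexp hnorm, Fintype.card_fin]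
      simp [χ, Pi.single_apply]
    have h72 : (72 : MvPolynomial N ℝ) = C 72 := (map_ofNat C 72).symm
    have h12 : (12 : MvPolynomial N ℝ) = C 12 := (map_ofNat C 12).symm
    have h96 : (96 : MvPolynomial N ℝ) = C 96 := (map_ofNat C 96).symm
    rw [defect, h72, h12, h96, sq (∑ j, _), Finset.sum_mul_sum]
    simp only [map_sub, ← smul_eq_C_mul, map_smul, map_sum, hX4, hXX, hprod, Finset.sum_const,
      Finset.card_univ, Fintype.card_fin, smul_eq_mul, nsmul_eq_mul]
    push_cast
    linear_combination (-96 * s ^ 4) * sgn_sq (β c)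
  have hn : (Fintype.card N : ℝ) ≠ 0 := fun h => by simp [h] at hs
  have hs4 : Fintype.card N * s ^ 4 = 1 / Fintype.card N := by
    rw [eq_div_iff hn]
    linear_combination (Fintype.card N * s ^ 2 + 1) * hs
  rw [hpoly]
  simp only [← smul_eq_C_mul, map_smul, map_sub, map_sum, hX4, hdef, hsq, smul_eq_mul,
    Finset.sum_const, Finset.card_univ, nsmul_eq_mul, hs4]
  ring

end Instance

/-! ### Existence of expanding and far from satisfiable systems -/

section Existence

/-- Some right-hand side is violated by every assignment on a constant fraction. -/
theorem exists_far_from_satisfiable {M N : Type*} [Fintype M] [Fintype N] [DecidableEq M]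
    [DecidableEq N] (hN : 0 < Fintype.card N) (hM : Fintype.card M = 2 * Fintype.card N)
    (L : (N → ZMod 2) → M → ZMod 2) :
    ∃ β : M → ZMod 2, ∀ z, Fintype.card N ≤ 8 * (Finset.univ.filter fun c => L z c ≠ β c).card := by
  set n := Fintype.card N
  have hsum : ∀ z, ∑ β : M → ZMod 2, ∏ c, (if L z c ≠ β c then (1 / 4 : ℝ) else 1) =
      (5 / 4) ^ (2 * n) := fun z => by
    have h := Finset.prod_univ_sum (fun _ : M => (Finset.univ : Finset (ZMod 2)))
      fun c b => if L z c ≠ b then (1 / 4 : ℝ) else 1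
    rw [Fintype.piFinset_univ] at h
    rw [← h, ← hM, ← Finset.card_univ, ← Finset.prod_const]
    refine Finset.prod_congr rfl fun c _ => ?_
    rw [sum_zmod_two]
    rcases zmod_two_cases (L z c) with h | h <;> rw [h] <;> norm_num
  obtain ⟨β, -, hβ⟩ := Finset.exists_le_of_sum_le (s := (Finset.univ : Finset (M → ZMod 2)))
    (f := fun β => ∑ z : N → ZMod 2, ∏ c, (if L z c ≠ β c then (1 / 4 : ℝ) else 1))
    (g := fun _ => (25 / 32) ^ n) Finset.univ_nonempty (by
      rw [Finset.sum_comm, Finset.sum_congr rfl fun z _ => hsum z]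
      simp only [Finset.sum_const, Finset.card_univ, Fintype.card_fun, ZMod.card, hM, nsmul_eq_mul]
      push_cast
      rw [pow_mul, pow_mul, ← mul_pow, ← mul_pow]
      norm_num
      exact le_rfl)
  refine ⟨β, fun z => ?_⟩
  by_contra! hlt
  set U := Finset.univ.filter fun c => L z c ≠ β c
  have hle : (1 / 4 : ℝ) ^ U.card ≤ (25 / 32) ^ n := by
    refine le_trans (le_of_eq ?_) ((Finset.single_le_sum
      (fun z' _ => Finset.prod_nonneg fun c _ => ?_)
      (Finset.mem_univ z)).trans hβ)
    · rw [Finset.prod_ite, Finset.prod_const, Finset.prod_const_one, mul_one]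
    · split_ifs <;> norm_num
  have h8 : (1 / 4 : ℝ) ^ n ≤ (1 / 4) ^ (8 * U.card) :=
    pow_le_pow_of_le_one (by norm_num) (by norm_num) hlt.le
  have h8' : (1 / 4 : ℝ) ^ (8 * U.card) ≤ ((25 / 32) ^ 8) ^ n := by
    rw [mul_comm, pow_mul, pow_right_comm (25 / 32)]
    exact pow_le_pow_left₀ (by positivity) hle 8
  have hlt' : ((25 / 32 : ℝ) ^ 8) ^ n < (1 / 4) ^ n :=
    pow_lt_pow_left₀ (by norm_num) (by positivity) hN.ne'
  linarith

theorem card_perm_mapsTo_le {α : Type*} [Fintype α] [DecidableEq α] (A B : Finset α) :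
    (Finset.univ.filter fun π : Equiv.Perm α => ∀ a ∈ A, π a ∈ B).card * Fintype.card α ^ A.card ≤
      (Fintype.card α).factorial * B.card ^ A.card := by
  set n := Fintype.card α
  induction A using Finset.induction_on with
  | empty => simp [Fintype.card_perm, n]
  | insert a A ha ih =>
    let S : Finset α → Finset (Equiv.Perm α) := fun A =>
      Finset.univ.filter fun π : Equiv.Perm α => ∀ a ∈ A, π a ∈ B
    change (S (insert a A)).card * _ ≤ _
    change (S A).card * _ ≤ _ at ih
    have hsymm : ∀ a' ∈ Aᶜ, (S (insert a' A)).card = (S (insert a A)).card := by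
      intro a' ha'
      have ha'' : a' ∉ A := Finset.mem_compl.1 ha'
      refine Finset.card_equiv (Equiv.mulRight (Equiv.swap a a')) fun π => ?_
      simp only [S, Finset.mem_filter, Finset.mem_univ, true_and, Equiv.coe_mulRight,
        Equiv.Perm.mul_apply, Finset.forall_mem_insert, Equiv.swap_apply_left]
      refine and_congr_right fun _ => forall₂_congr fun x hx => ?_
      rw [Equiv.swap_apply_of_ne_of_ne (ne_of_mem_of_not_mem hx ha)
        (ne_of_mem_of_not_mem hx ha'')]
    have hcount : ∑ a' ∈ Aᶜ, (S (insert a' A)).card = (S A).card * (B.card - A.card) := by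
      have h1 : ∀ a' ∈ Aᶜ, (S (insert a' A)).card = ∑ π ∈ S A, if π a' ∈ B then 1 else 0 := by
        intro a' _
        rw [Finset.sum_boole, Nat.cast_id]
        congr 1
        ext π
        simp [S, and_comm]
      rw [Finset.sum_congr rfl h1, Finset.sum_comm, ← smul_eq_mul, ← Finset.sum_const]
      refine Finset.sum_congr rfl fun π hπ => ?_
      have hπ' : ∀ a ∈ A, π a ∈ B := (Finset.mem_filter.1 hπ).2
      rw [Finset.sum_boole, Nat.cast_id]
      have himg : (Aᶜ.filter fun a' => π a' ∈ B) = B.map π.symm.toEmbedding \ A := by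
        ext x
        simp [and_comm, Finset.mem_map_equiv]
      rw [himg, Finset.card_sdiff_of_subset, Finset.card_map]
      intro x hx
      simpa [Finset.mem_map_equiv] using hπ' x hx
    rw [Finset.sum_congr rfl hsymm, Finset.sum_const, Finset.card_compl, smul_eq_mul] at hcount
    have hA : A.card < n := Finset.card_lt_univ_of_notMem ha
    have hB : B.card ≤ n := Finset.card_le_univ B
    have hstep : (S (insert a A)).card * n ≤ (S A).card * B.card := by
      have h1 : n * (B.card - A.card) ≤ (n - A.card) * B.card := by
        rcases le_total A.card B.card with h | h
        · zify [h, hA.le]; nlinarith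
        · simp [Nat.sub_eq_zero_of_le h]
      refine Nat.le_of_mul_le_mul_left ?_ (Nat.sub_pos_of_lt hA)
      calc (n - A.card) * ((S (insert a A)).card * n)
          = ((n - A.card) * (S (insert a A)).card) * n := by ring
        _ = (S A).card * (n * (B.card - A.card)) := by rw [hcount]; ring
        _ ≤ (S A).card * ((n - A.card) * B.card) := Nat.mul_le_mul_left _ h1
        _ = _ := by ring
    rw [Finset.card_insert_of_notMem ha, pow_succ, pow_succ]
    calc (S (insert a A)).card * (n ^ A.card * n)
        = ((S (insert a A)).card * n) * n ^ A.card := by ring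
      _ ≤ ((S A).card * B.card) * n ^ A.card := Nat.mul_le_mul_right _ hstep
      _ = ((S A).card * n ^ A.card) * B.card := by ring
      _ ≤ (n.factorial * B.card ^ A.card) * B.card := Nat.mul_le_mul_right _ ih
      _ = _ := by ring

/-- The system of four-variable constraints with supports
`{a, π (t, 0) a, π (t, 1) a, π (t, 2) a}`. -/
def permSystem {α : Type*} (π : Fin 2 × Fin 3 → Equiv.Perm α) (c : Fin 2 × α) : Fin 4 → α :=
  Fin.cons c.2 fun j => π (c.1, j) c.2

theorem permSystem_regular {α : Type*} [Fintype α] (π : Fin 2 × Fin 3 → Equiv.Perm α) (h : α → ℝ) :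
    ∑ c, ∑ j, h (permSystem π c j) = 8 * ∑ a, h a := by
  simp only [permSystem, Fin.sum_univ_succ (n := 3), Fin.cons_zero, Fin.cons_succ,
    Finset.sum_add_distrib, Fintype.sum_prod_type]
  rw [Finset.sum_congr rfl fun t _ => Finset.sum_comm]
  simp only [Equiv.sum_comp (π _) h, Finset.sum_const, Finset.card_univ, Fintype.card_fin,
    nsmul_eq_mul]
  push_cast
  ring

/-- The variables that occur in a set of constraints. -/
def nbhd {M N : Type*} [DecidableEq N] (v : M → Fin 4 → N) (F : Finset M) : Finset N :=
  F.biUnion fun c => Finset.univ.image (v c)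

theorem card_permSystem_mem_le {α : Type*} [Fintype α] [DecidableEq α] [Nonempty α]
    (B : Finset α) (F : Finset (Fin 2 × α)) :
    ((Finset.univ.filter fun π : Fin 2 × Fin 3 → Equiv.Perm α =>
      nbhd (permSystem π) F ⊆ B).card : ℝ) ≤
      (Fintype.card α).factorial ^ 6 * ((B.card : ℝ) / Fintype.card α) ^ (3 * F.card) := by
  set n := Fintype.card α
  have hn : (0 : ℝ) < n := Nat.cast_pos.2 Fintype.card_pos
  let A : Fin 2 → Finset α := fun t => Finset.univ.filter fun a => (t, a) ∈ F
  have hA : ∑ t, (A t).card = F.card := by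
    simp only [A, Finset.card_filter]
    rw [← Fintype.sum_prod_type' fun t a => if (t, a) ∈ F then 1 else 0]
    simp
  let S : Fin 2 × Fin 3 → Finset (Equiv.Perm α) := fun p =>
    Finset.univ.filter fun π => ∀ a ∈ A p.1, π a ∈ B
  have hS : ∀ p, ((S p).card : ℝ) ≤ n.factorial * ((B.card : ℝ) / n) ^ (A p.1).card := fun p => by
    have := (Nat.cast_le (α := ℝ)).2 (card_perm_mapsTo_le (A p.1) B)
    rw [div_pow, ← mul_div_assoc, le_div_iff₀ (by positivity)]
    simpa using this
  calc _ ≤ ((Fintype.piFinset S).card : ℝ) := by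
        refine Nat.cast_le.2 (Finset.card_le_card fun π hπ => ?_)
        have hπ' : nbhd (permSystem π) F ⊆ B := (Finset.mem_filter.1 hπ).2
        refine Fintype.mem_piFinset.2 fun p => Finset.mem_filter.2 ⟨Finset.mem_univ _, ?_⟩
        intro a ha
        refine hπ' (Finset.mem_biUnion.2 ⟨(p.1, a), (Finset.mem_filter.1 ha).2, ?_⟩)
        exact Finset.mem_image.2 ⟨p.2.succ, Finset.mem_univ _, rfl⟩
    _ ≤ ∏ p : Fin 2 × Fin 3, (n.factorial * ((B.card : ℝ) / n) ^ (A p.1).card) := by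
        rw [Fintype.card_piFinset, Nat.cast_prod]
        exact Finset.prod_le_prod (fun p _ => Nat.cast_nonneg _) fun p _ => hS p
    _ = _ := by
        rw [Finset.prod_mul_distrib, Finset.prod_const, Finset.prod_pow_eq_pow_sum,
          Fintype.sum_prod_type]
        simp only [Finset.sum_const, Finset.card_univ, Fintype.card_fin, Fintype.card_prod,
          smul_eq_mul]
        rw [← Finset.mul_sum, hA]

theorem choose_mul_div_pow_le (n b : ℕ) : (n.choose b : ℝ) * ((b : ℝ) / n) ^ b ≤ 4 ^ b := by
  rcases Nat.eq_zero_or_pos n with rfl | hn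
  · rcases b with _ | b <;> simp
  have h1 : (n.choose b : ℝ) ≤ n ^ b / b.factorial := Nat.choose_le_pow_div b n
  have h2 : (b : ℝ) ^ b / b.factorial ≤ 4 ^ b := by
    refine (Real.pow_div_factorial_le_exp (b : ℝ) (Nat.cast_nonneg b) b).trans ?_
    rw [← mul_one (b : ℝ), Real.exp_nat_mul]
    exact pow_le_pow_left₀ (Real.exp_pos _).le (by linarith [Real.exp_one_lt_d9]) b
  refine le_trans (mul_le_mul_of_nonneg_right h1 (by positivity)) (le_trans (le_of_eq ?_) h2)
  have : (n : ℝ) ≠ 0 := Nat.cast_ne_zero.2 hn.ne'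
  rw [div_mul_eq_mul_div, ← mul_pow, mul_div_cancel₀ _ this]

theorem exists_expanding_permSystem {α : Type*} [Fintype α] [DecidableEq α] {ℓ : ℕ} (hℓ : 1 ≤ ℓ)
    (hα : Fintype.card α = 5 * 2 ^ 30 * ℓ) :
    ∃ π : Fin 2 × Fin 3 → Equiv.Perm α, ∀ F : Finset (Fin 2 × α), F.card ≤ 2 * ℓ →
      5 * F.card ≤ 2 * (nbhd (permSystem π) F).card := by
  by_contra! hbad
  set n := Fintype.card α
  have hn : 0 < n := by omega
  have hn' : (0 : ℝ) < n := Nat.cast_pos.2 hn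
  have : Nonempty α := Fintype.card_pos_iff.1 hn
  let fam : Finset α → Finset (Finset (Fin 2 × α)) := fun B =>
    (Finset.univ ×ˢ B).powerset.filter fun F => F.card ≤ 2 * ℓ ∧ 2 * B.card < 5 * F.card
  let g : ℕ → ℝ := fun b => if b = 0 then 0 else ((b : ℝ) / n) ^ b * (1 / 16) ^ b
  let T : ℝ := (n.factorial : ℝ) ^ 6
  have hT : 0 < T := by positivity
  have hF : ∀ B, ∀ F ∈ fam B, ((B.card : ℝ) / n) ^ (3 * F.card) ≤
      ((B.card : ℝ) / n) ^ B.card * (1 / 64) ^ B.card := by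
    intro B F hF
    obtain ⟨-, hF1, hF2⟩ := Finset.mem_filter.1 hF
    have hx : (B.card : ℝ) / n ≤ (1 / 64) ^ 5 := by
      rw [div_le_iff₀ hn', hα]
      have : (B.card : ℝ) ≤ 5 * ℓ := by exact_mod_cast (by omega : B.card ≤ 5 * ℓ)
      push_cast
      linarith
    have hx0 : (0 : ℝ) ≤ (B.card : ℝ) / n := by positivity
    rw [show 3 * F.card = B.card + (3 * F.card - B.card) by omega, pow_add]
    refine mul_le_mul_of_nonneg_left ?_ (by positivity)
    refine (pow_le_pow_left₀ hx0 hx _).trans ?_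
    rw [← pow_mul]
    exact pow_le_pow_of_le_one (by norm_num) (by norm_num) (by omega)
  have hB : ∀ B, ∑ F ∈ fam B, ((B.card : ℝ) / n) ^ (3 * F.card) ≤ g B.card := by
    intro B
    by_cases h0 : B.card = 0
    · have : fam B = ∅ := by
        rw [Finset.card_eq_zero] at h0
        refine Finset.filter_eq_empty_iff.2 fun F hF => ?_
        rw [Finset.mem_powerset, h0, Finset.product_empty, Finset.subset_empty] at hF
        simp [hF]
      simp [this, g, h0]
    · refine (Finset.sum_le_card_nsmul _ _ _ (hF B)).trans ?_
      have hcard : ((fam B).card : ℝ) ≤ 4 ^ B.card := by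
        have : (fam B).card ≤ 4 ^ B.card := by
          refine (Finset.card_filter_le _ _).trans (le_of_eq ?_)
          rw [Finset.card_powerset, Finset.card_product, Finset.card_univ, Fintype.card_fin,
            pow_mul]
          norm_num
        exact_mod_cast this
      rw [nsmul_eq_mul]
      refine (mul_le_mul_of_nonneg_right hcard (by positivity)).trans (le_of_eq ?_)
      simp only [g, if_neg h0]
      rw [mul_left_comm, ← mul_pow]
      norm_num
  have hunion : (Finset.univ : Finset (Fin 2 × Fin 3 → Equiv.Perm α)) ⊆
      Finset.univ.biUnion fun B => (fam B).biUnion fun F =>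
        Finset.univ.filter fun π => nbhd (permSystem π) F ⊆ B := by
    intro π _
    obtain ⟨F, hF1, hF2⟩ := hbad π
    simp only [Finset.mem_biUnion, Finset.mem_univ, true_and, Finset.mem_filter]
    refine ⟨nbhd (permSystem π) F, F, Finset.mem_filter.2 ⟨Finset.mem_powerset.2 fun c hc => ?_,
      hF1, hF2⟩, subset_rfl⟩
    refine Finset.mem_product.2 ⟨Finset.mem_univ _, Finset.mem_biUnion.2 ⟨c, hc, ?_⟩⟩
    exact Finset.mem_image.2 ⟨0, Finset.mem_univ _, rfl⟩
  have htotal : T ≤ T * ∑ B : Finset α, g B.card := by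
    calc T = ((Finset.univ : Finset (Fin 2 × Fin 3 → Equiv.Perm α)).card : ℝ) := by
          simp [T, Finset.card_univ, Fintype.card_perm, n]
      _ ≤ ((∑ B, ∑ F ∈ fam B, (Finset.univ.filter fun π : Fin 2 × Fin 3 → Equiv.Perm α =>
            nbhd (permSystem π) F ⊆ B).card : ℕ) : ℝ) :=
          Nat.cast_le.2 ((Finset.card_le_card hunion).trans (Finset.card_biUnion_le.trans
            (Finset.sum_le_sum fun B _ => Finset.card_biUnion_le)))
      _ ≤ ∑ B, ∑ F ∈ fam B, T * ((B.card : ℝ) / n) ^ (3 * F.card) := by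
          push_cast
          exact Finset.sum_le_sum fun B _ => Finset.sum_le_sum fun F _ =>
            card_permSystem_mem_le B F
      _ ≤ T * ∑ B : Finset α, g B.card := by
          simp_rw [← Finset.mul_sum]
          exact mul_le_mul_of_nonneg_left (Finset.sum_le_sum fun B _ => hB B) hT.le
  have hsmall : ∑ B : Finset α, g B.card < 1 := by
    rw [← Finset.powerset_univ, Finset.sum_powerset_apply_card, Finset.card_univ,
      Finset.sum_range_succ']
    have hterm : ∀ b ∈ Finset.range n, n.choose (b + 1) • g (b + 1) ≤ 1 / 4 * (1 / 4) ^ b := by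
      intro b _
      have h := mul_le_mul_of_nonneg_right (choose_mul_div_pow_le n (b + 1))
        (by positivity : (0 : ℝ) ≤ (1 / 16) ^ (b + 1))
      rw [← mul_pow] at h
      simp only [g, if_neg (Nat.succ_ne_zero b), nsmul_eq_mul]
      refine le_trans (le_of_eq (by ring)) (h.trans (le_of_eq ?_))
      rw [pow_succ']
      norm_num
    have hgeom : ∑ b ∈ Finset.range n, (1 / 4 : ℝ) * (1 / 4) ^ b ≤ 1 / 3 := by
      rw [← Finset.mul_sum, geom_sum_eq (by norm_num)]
      have : (0 : ℝ) ≤ (1 / 4) ^ n := by positivity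
      rw [show (1 / 4 : ℝ) * (((1 / 4) ^ n - 1) / (1 / 4 - 1)) = (1 - (1 / 4) ^ n) / 3 by ring]
      linarith
    have := Finset.sum_le_sum hterm
    simp only [g, if_true, smul_zero, add_zero] at this ⊢
    linarith
  nlinarith

/-- Sets of constraints with many variables have large boundary. -/
theorem le_hammingNorm_boundary {M N : Type*} [Fintype M] [Fintype N] [DecidableEq N]
    {v : M → Fin 4 → N} {k : ℕ}
    (h : ∀ F : Finset M, F.card ≤ k → 5 * F.card ≤ 2 * (nbhd v F).card)
    (F : M → ZMod 2) (hF : hammingNorm F ≤ k) :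
    hammingNorm F ≤ hammingNorm (boundary v F) := by
  set supp : Finset M := Finset.univ.filter fun c => F c ≠ 0
  have hs : hammingNorm F = supp.card := rfl
  let slots : N → ℕ := fun i => ∑ c ∈ supp, ∑ j, if v c j = i then 1 else 0
  have hslots : ∀ i, boundary v F i = slots i := fun i => by
    simp only [boundary, AddMonoidHom.coe_mk, ZeroHom.coe_mk, slots]
    push_cast
    rw [Finset.sum_filter]
    refine Finset.sum_congr rfl fun c _ => ?_
    rcases zmod_two_cases (F c) with h | h <;> simp [h]
  have hpos : ∀ i ∈ nbhd v supp, 1 ≤ slots i := fun i hi => by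
    obtain ⟨c, hc, hi⟩ := Finset.mem_biUnion.1 hi
    obtain ⟨j, -, rfl⟩ := Finset.mem_image.1 hi
    refine le_trans ?_ (Finset.single_le_sum (fun _ _ => Nat.zero_le _) hc)
    refine le_trans ?_ (Finset.single_le_sum (fun _ _ => Nat.zero_le _) (Finset.mem_univ j))
    simp
  have htwo : ∀ i ∈ nbhd v supp, 2 ≤ slots i + if boundary v F i ≠ 0 then 1 else 0 := by
    intro i hi
    have h1 := hpos i hi
    split_ifs with h0
    · omega
    · rw [hslots, not_not, ZMod.natCast_eq_zero_iff] at h0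
      have := Nat.le_of_dvd h1 h0
      omega
  have hsum : ∑ i ∈ nbhd v supp, slots i ≤ 4 * supp.card := by
    refine (Finset.sum_le_univ_sum_of_nonneg fun _ => Nat.zero_le _).trans (le_of_eq ?_)
    simp only [slots]
    rw [Finset.sum_comm, Finset.sum_congr rfl fun c _ => Finset.sum_comm]
    simp [mul_comm]
  have hcard : ∑ i ∈ nbhd v supp, (if boundary v F i ≠ 0 then 1 else 0) ≤
      hammingNorm (boundary v F) := by
    refine (Finset.sum_le_univ_sum_of_nonneg fun _ => Nat.zero_le _).trans (le_of_eq ?_)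
    rw [Finset.sum_boole]
    rfl
  have h2 := Finset.sum_le_sum htwo
  rw [Finset.sum_const, Finset.sum_add_distrib, smul_eq_mul] at h2
  have := h supp (hs ▸ hF)
  omega

end Existence

/-! ### The gap instance -/

section Gap

theorem sum_reindex_mul_pow_four {R ι κ μ : Type*} [Fintype R] [Fintype ι] [Fintype κ] [Fintype μ]
    (ε : κ ≃ ι) (ρ : μ ≃ R) (A : R → ι → ℝ) (x : κ → ℝ) :
    ∑ a, (∑ i, A (ρ a) (ε i) * x i) ^ 4 = ∑ a, (∑ I, A a I * x (ε.symm I)) ^ 4 := by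
  rw [← Equiv.sum_comp ρ]
  refine Finset.sum_congr rfl fun a _ => ?_
  rw [← Equiv.sum_comp ε]
  simp

theorem two_mul_pow_le {n : ℕ} (hn : 1 ≤ n) :
    0 < (2 : ℝ) ^ n * (1875 - 744 / n) ∧
    2 * ((2 : ℝ) ^ n * (1875 - 744 / n)) ^ (400 * n) ≤
      ((2 : ℝ) ^ n * (1875 - 738 / n)) ^ (400 * n) := by
  have hn0 : (1 : ℝ) ≤ n := by exact_mod_cast hn
  have hinv : (744 : ℝ) / n ≤ 744 := div_le_self (by norm_num) hn0
  have hP : 0 < (2 : ℝ) ^ n * (1875 - 744 / n) := by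
    have : (0 : ℝ) < 1875 - 744 / n := by linarith
    positivity
  refine ⟨hP, ?_⟩
  have hstep : (1 + 1 / (400 * n : ℝ)) * ((2 : ℝ) ^ n * (1875 - 744 / n)) ≤
      (2 : ℝ) ^ n * (1875 - 738 / n) := by
    rw [mul_left_comm]
    refine mul_le_mul_of_nonneg_left ?_ (by positivity)
    have hu : (0 : ℝ) < 1 / n := by positivity
    rw [show (744 : ℝ) / n = 744 * (1 / n) by ring, show (738 : ℝ) / n = 738 * (1 / n) by ring,
      show 1 / (400 * n : ℝ) = 1 / 400 * (1 / n) by field_simp]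
    nlinarith
  have hbern : (2 : ℝ) ≤ (1 + 1 / (400 * n : ℝ)) ^ (400 * n) := by
    have hpos : (0 : ℝ) < 1 / (400 * n : ℝ) := by positivity
    refine le_trans (le_of_eq ?_) (one_add_mul_le_pow (by linarith) (400 * n))
    push_cast
    field_simp
    norm_num
  calc 2 * ((2 : ℝ) ^ n * (1875 - 744 / n)) ^ (400 * n)
      ≤ (1 + 1 / (400 * n : ℝ)) ^ (400 * n) * ((2 : ℝ) ^ n * (1875 - 744 / n)) ^ (400 * n) :=
        mul_le_mul_of_nonneg_right hbern (by positivity)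
    _ = ((1 + 1 / (400 * n : ℝ)) * ((2 : ℝ) ^ n * (1875 - 744 / n))) ^ (400 * n) :=
        (mul_pow _ _ _).symm
    _ ≤ _ := pow_le_pow_left₀ (by positivity) hstep _

theorem log_div_log_log_pow_self_le {n : ℕ} (hn : 3 ≤ n) :
    Real.log ((n ^ (400 * n) : ℕ) : ℝ) / Real.log (Real.log ((n ^ (400 * n) : ℕ) : ℝ)) ≤
      400 * n := by
  have hn0 : (3 : ℝ) ≤ n := by exact_mod_cast hn
  have hlog : 1 ≤ Real.log n := by
    rw [Real.le_log_iff_exp_le (by linarith)]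
    linarith [Real.exp_one_lt_d9]
  have hd : Real.log ((n ^ (400 * n) : ℕ) : ℝ) = 400 * n * Real.log n := by
    push_cast
    rw [Real.log_pow]
    push_cast
    ring
  rw [hd]
  have hle : Real.log n ≤ Real.log (400 * n * Real.log n) :=
    Real.log_le_log (by linarith) (by nlinarith)
  rw [div_le_iff₀ (by linarith)]
  exact mul_le_mul_of_nonneg_left hle (by positivity)

end Gap

end SoSGap

/-- SoS integrality gap for the `2→4` norm: for infinitely many
dimensions `d` there is a matrix `A` and a pseudo-expectation of degree
`ℓ ≥ c·log d / (log log d)^e` satisfying the unit-sphere constraint whose value on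
`Σ_a ⟨A_a, x⟩⁴` exceeds `C⁴·‖A‖_{2→4}⁴`. -/
theorem sos_integrality_gap_twoToFour_norm :
    ∃ (Cgap c : ℝ) (e : ℕ) (d₀ : ℕ), 1 < Cgap ∧ 0 < c ∧
      ∀ D : ℕ, ∃ d : ℕ, D ≤ d ∧ d₀ ≤ d ∧
        ∃ (m : ℕ) (A : Fin m → Fin d → ℝ) (ℓ : ℕ)
          (E : MvPolynomial (Fin d) ℝ →ₗ[ℝ] ℝ),
          c * Real.log d / (Real.log (Real.log d)) ^ e ≤ (ℓ : ℝ) ∧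
          E 1 = 1 ∧
          (∀ p : MvPolynomial (Fin d) ℝ, p.totalDegree ≤ ℓ / 2 → 0 ≤ E (p ^ 2)) ∧
          (∀ q : MvPolynomial (Fin d) ℝ, q.totalDegree ≤ ℓ - 2 →
            E (((∑ i, X i ^ 2) - 1) * q) = 0) ∧
          Cgap ^ 4 * sSup { t : ℝ | ∃ x : Fin d → ℝ, (∑ i, (x i) ^ 2) = 1 ∧
              t = ∑ a, (∑ i, A a i * x i) ^ 4 }
            < E (∑ a, (∑ i, C (A a i) * X i) ^ 4) := by
  refine ⟨11 / 10, 1 / (2000 * 2 ^ 30), 1, 0, by norm_num, by norm_num, fun D => ?_⟩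
  obtain ⟨ℓ, hℓ⟩ : ∃ ℓ, ℓ = D + 1 := ⟨_, rfl⟩
  obtain ⟨n, hn⟩ : ∃ n, n = 5 * 2 ^ 30 * ℓ := ⟨_, rfl⟩
  have hn1 : 3 ≤ n := by omega
  have hcard : Fintype.card (Fin n) = n := Fintype.card_fin n
  obtain ⟨π, hπ⟩ := SoSGap.exists_expanding_permSystem (α := Fin n) (by omega : 1 ≤ ℓ)
    (hcard.trans hn)
  set v := SoSGap.permSystem π
  have hreg : ∀ h : Fin n → ℝ, ∑ c, ∑ j, h (v c j) = 8 * ∑ i, h i := SoSGap.permSystem_regular π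
  have hexp := SoSGap.le_hammingNorm_boundary hπ
  obtain ⟨β, hβ⟩ := SoSGap.exists_far_from_satisfiable (M := Fin 2 × Fin n) (N := Fin n)
    (by omega) (by simp) fun z c => ∑ j, z (v c j)
  obtain ⟨k, hk⟩ : ∃ k, k = 400 * n := ⟨_, rfl⟩
  let ε : Fin (n ^ k) ≃ (Fin k → Fin n) := finFunctionFinEquiv.symm
  let R := ((Fin 2 × Fin n) × (ZMod 2 × ZMod 2) × (Fin n → ZMod 2)) ⊕ (Fin n → ZMod 2)
  let ρ : Fin (Fintype.card (Fin k → R)) ≃ (Fin k → R) := (Fintype.equivFin _).symm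
  let s : ℝ := (√n)⁻¹
  have hs : (n : ℝ) * s ^ 2 = 1 := by
    have : (n : ℝ) ≠ 0 := by positivity
    simp only [s, inv_pow, Real.sq_sqrt (Nat.cast_nonneg n)]
    exact mul_inv_cancel₀ this
  let χ : ((Fin 2 × Fin n) → ZMod 2) → ℝ := fun F => SoSGap.sgn (∑ c, β c * F c)
  have hχ0 : χ 0 = 1 := by simp [χ, SoSGap.sgn]
  obtain ⟨hP, hgap⟩ := SoSGap.two_mul_pow_le (by omega : 1 ≤ n)
  rw [← hk] at hgap
  refine ⟨n ^ k, ?_, Nat.zero_le _, Fintype.card (Fin k → R),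
    fun a i => ∏ j, SoSGap.baseRow v β (ρ a j) (ε i j), ℓ,
    SoSGap.functional (fun T : Fin k → Fin n → ZMod 2 =>
        ∏ j, SoSGap.parityVal (SoSGap.boundary v) χ ℓ (T j))
      (fun i j => Pi.single (ε i j) 1) (s ^ k), ?_, ?_, ?_, ?_, ?_⟩
  · calc D ≤ n ^ 1 := by rw [pow_one]; omega
      _ ≤ n ^ k := Nat.pow_le_pow_right (by omega) (by omega)
  · have h := SoSGap.log_div_log_log_pow_self_le hn1
    rw [← hk] at h
    rw [pow_one, mul_div_assoc]
    refine (mul_le_mul_of_nonneg_left h (by norm_num)).trans (le_of_eq ?_)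
    rw [hn]
    push_cast
    ring
  · refine SoSGap.functional_one _ _ _ ?_
    exact Finset.prod_eq_one fun j _ => SoSGap.parityVal_zero hexp hχ0
  · intro p hp
    refine SoSGap.functional_parity_sq_nonneg hexp hχ0 (SoSGap.sgn_sum_mul_add β) _ ?_ _ p hp
    intro i j
    simp [hammingNorm, Pi.single_apply, Finset.filter_eq']
  · intro q _
    refine SoSGap.functional_sphere _ _ _ (fun T => funext fun j => SoSGap.add_self_zmod (T j)) ?_ q
    rw [Fintype.card_fin, Nat.cast_pow, pow_right_comm, ← mul_pow, hs, one_pow]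
  · refine lt_of_lt_of_eq ?_ (SoSGap.functional_tensor_pow (SoSGap.baseRow v β)
      (SoSGap.parityVal (SoSGap.boundary v) χ ℓ) (fun t => Pi.single t 1) s k ε ρ).symm
    rw [SoSGap.functional_sum_baseRow hreg β (by omega) hexp (by rw [hcard]; exact hs), hcard]
    have hsup : sSup { t : ℝ | ∃ x : Fin (n ^ k) → ℝ, (∑ i, (x i) ^ 2) = 1 ∧
        t = ∑ a, (∑ i, (∏ j, SoSGap.baseRow v β (ρ a j) (ε i j)) * x i) ^ 4 } ≤
        ((2 : ℝ) ^ n * (1875 - 744 / n)) ^ k := by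
      refine Real.sSup_le ?_ (by positivity)
      rintro t ⟨x, hx, rfl⟩
      rw [SoSGap.sum_reindex_mul_pow_four ε ρ
        (fun a I => ∏ j, SoSGap.baseRow v β (a j) (I j)) x]
      have hbase := SoSGap.sum_baseRow_le hreg β (by omega) hβ
      rw [hcard] at hbase
      refine (SoSGap.tensor_pow_bound hP.le hbase k fun I => x (ε.symm I)).trans (le_of_eq ?_)
      rw [Equiv.sum_comp ε.symm fun i => x i ^ 2, hx]
      ring
    have hPk : 0 < ((2 : ℝ) ^ n * (1875 - 744 / n)) ^ k := by positivity
    norm_num at hsup ⊢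
    linarith
end
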